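/- Let (e,t) ∈ [0,1]² be such that there exists at least one graphon g with e(g) = e and t(g) = t. Then the double limit s_{e,t} = lim_{δ→0⁺} lim_{n→∞} ln(Z^{n,δ}_{e,t})/n² exists and equals −min{ I(g) : g a graphon with e(g) = e and t(g) = t }, the minimum being attained by some graphon. -/

import Mathlib

open MeasureTheory Real Set Filter

noncomputable section

/-- `I₀(u) = (1/2)[u ln u + (1-u) ln(1-u)]`, with the convention `log 0 = 0`
    giving `I₀(0) = I₀(1) = 0`. -/
def I0 (u : ℝ) : ℝ := (u * Real.log u + (1 - u) * Real.log (1 - u)) / 2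

/-- `I₀'(u) = (1/2)[ln u − ln(1−u)]`. -/
def I0d (u : ℝ) : ℝ := (Real.log u - Real.log (1 - u)) / 2

/-- `I₀''(u) = (1/2)[1/u + 1/(1−u)]`. -/
def I0dd (u : ℝ) : ℝ := (1 / u + 1 / (1 - u)) / 2

/-- A graphon: a measurable, symmetric function `[0,1]² → [0,1]`
    (here defined on all of `ℝ²`, with values used only on `[0,1]²`). -/
def IsGraphon (g : ℝ → ℝ → ℝ) : Prop :=
  Measurable (Function.uncurry g) ∧ (∀ x y, g x y = g y x) ∧ ∀ x y, g x y ∈ Icc (0 : ℝ) 1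

/-- The edge density `e(g) = ∫₀¹∫₀¹ g(x,y) dx dy`. -/
def edgeDensity (g : ℝ → ℝ → ℝ) : ℝ :=
  ∫ x in Icc (0 : ℝ) 1, ∫ y in Icc (0 : ℝ) 1, g x y

/-- The triangle density `t(g) = ∫₀¹∫₀¹∫₀¹ g(x,y) g(y,z) g(z,x) dx dy dz`. -/
def triangleDensity (g : ℝ → ℝ → ℝ) : ℝ :=
  ∫ x in Icc (0 : ℝ) 1, ∫ y in Icc (0 : ℝ) 1, ∫ z in Icc (0 : ℝ) 1, g x y * g y z * g z x

/-- The rate function `I(g) = ∫₀¹∫₀¹ I₀(g(x,y)) dx dy`. -/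
def rate (g : ℝ → ℝ → ℝ) : ℝ :=
  ∫ x in Icc (0 : ℝ) 1, ∫ y in Icc (0 : ℝ) 1, I0 (g x y)

/-- Lebesgue measure restricted to `[0,1]`. -/
def unitMeasure : Measure ℝ := volume.restrict (Icc (0 : ℝ) 1)

/-- Two graphons are equivalent if they agree a.e. after composing with
    measure-preserving maps of `[0,1]`. -/
def GraphonEquiv (f g : ℝ → ℝ → ℝ) : Prop :=
  ∃ σ σ' : ℝ → ℝ, MeasurePreserving σ unitMeasure unitMeasure ∧
    MeasurePreserving σ' unitMeasure unitMeasure ∧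
    ∀ᵐ p ∂(unitMeasure.prod unitMeasure), f (σ p.1) (σ p.2) = g (σ' p.1) (σ' p.2)

end

noncomputable section

/-- Edge density of a finite simple graph on `n` labelled vertices. -/
def graphEdgeDensity {n : ℕ} (G : SimpleGraph (Fin n)) : ℝ :=
  (Nat.card G.edgeSet : ℝ) / (n.choose 2 : ℝ)

/-- Triangle density of a finite simple graph on `n` labelled vertices. -/
def graphTriangleDensity {n : ℕ} (G : SimpleGraph (Fin n)) : ℝ :=
  (Nat.card {s : Finset (Fin n) // G.IsNClique 3 s} : ℝ) / (n.choose 3 : ℝ)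

/-- `Z^{n,δ}_{e,t}`: the number of simple graphs on `n` labelled vertices whose
    edge density lies in `(e−δ, e+δ)` and triangle density lies in `(t−δ, t+δ)`. -/
def Z (n : ℕ) (δ e t : ℝ) : ℕ :=
  Nat.card {G : SimpleGraph (Fin n) //
    graphEdgeDensity G ∈ Ioo (e - δ) (e + δ) ∧ graphTriangleDensity G ∈ Ioo (t - δ) (t + δ)}

end

open ProbabilityTheory

theorem integrable_of_abs_le {Ω : Type*} [MeasurableSpace Ω] {μ : Measure Ω} [IsFiniteMeasure μ]
    {f : Ω → ℝ} (hf : Measurable f) (C : ℝ) (h : ∀ x, |f x| ≤ C) : Integrable f μ :=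
  Integrable.of_bound hf.aestronglyMeasurable C (ae_of_all _ h)

theorem abs_integral_le_of_abs_le {Ω : Type*} [MeasurableSpace Ω] {μ : Measure Ω}
    [IsProbabilityMeasure μ] {f : Ω → ℝ} {C : ℝ} (h : ∀ x, |f x| ≤ C) :
    |∫ x, f x ∂μ| ≤ C := by
  simpa using norm_integral_le_of_norm_le_const (μ := μ) (f := f) (C := C) (ae_of_all _ h)

/-- Measurable functions bounded by one in absolute value. -/
def UnitFun {Ω : Type*} [MeasurableSpace Ω] (a : Ω → ℝ) : Prop :=
  Measurable a ∧ ∀ x, |a x| ≤ 1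

/-- The kernel `R` has cut norm at most `ε` with respect to `μ`. -/
def CutLE {Ω : Type*} [MeasurableSpace Ω] (μ : Measure Ω) (R : Ω × Ω → ℝ) (ε : ℝ) : Prop :=
  ∀ a b : Ω → ℝ, UnitFun a → UnitFun b → |∫ p, R p * (a p.1 * b p.2) ∂(μ.prod μ)| ≤ ε

section Cut

variable {Ω : Type*} [MeasurableSpace Ω] {μ : Measure Ω} [IsProbabilityMeasure μ]

theorem exists_sign_integral_ge {F : Ω → ℝ} {C : ℝ} (hF : Measurable F) (hC : ∀ x, |F x| ≤ C) :
    ∃ s : Ω → ℝ, Measurable s ∧ (∀ x, s x ∈ ({-1, 0, 1} : Set ℝ)) ∧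
      ∀ a : Ω → ℝ, UnitFun a → |∫ x, F x * a x ∂μ| ≤ ∫ x, F x * s x ∂μ := by
  refine ⟨fun x => if F x < 0 then -1 else 1,
    Measurable.ite (measurableSet_lt hF measurable_const) measurable_const measurable_const,
    fun x => ?_, fun a ha => ?_⟩
  · by_cases h : F x < 0 <;> simp [h]
  · have hs : ∀ x, F x * (if F x < 0 then -1 else 1) = |F x| := by
      intro x
      by_cases h : F x < 0
      · simp [h, abs_of_neg h]
      · simp [h, abs_of_nonneg (not_lt.mp h)]
    simp only [hs]
    refine (abs_integral_le_integral_abs).trans (integral_mono ?_ ?_ fun x => ?_)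
    · refine integrable_of_abs_le (hF.mul ha.1).abs C fun x => ?_
      rw [abs_abs, abs_mul]
      nlinarith [hC x, ha.2 x, abs_nonneg (F x), abs_nonneg (a x)]
    · exact integrable_of_abs_le hF.abs C fun x => by rw [abs_abs]; exact hC x
    · simp only [abs_mul]
      nlinarith [hC x, ha.2 x, abs_nonneg (F x), abs_nonneg (a x)]

theorem unitFun_of_mem_signs {s : Ω → ℝ} (hs : Measurable s)
    (h : ∀ x, s x ∈ ({-1, 0, 1} : Set ℝ)) : UnitFun s :=
  ⟨hs, fun x => by rcases h x with h | h | h <;> simp_all⟩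

theorem abs_mul_unit_le {x y z C : ℝ} (hx : |x| ≤ C) (hy : |y| ≤ 1) (hz : |z| ≤ 1) :
    |x * (y * z)| ≤ C := by
  rw [abs_mul, abs_mul]
  calc |x| * (|y| * |z|) ≤ |x| * 1 := by
        gcongr
        exact mul_le_one₀ hy (abs_nonneg _) hz
    _ ≤ C := by simpa using hx

theorem integral_prod_unit {R : Ω × Ω → ℝ} {C : ℝ} (hR : Measurable R) (hC : ∀ p, |R p| ≤ C)
    {a b : Ω → ℝ} (ha : UnitFun a) (hb : UnitFun b) :
    ∫ p, R p * (a p.1 * b p.2) ∂(μ.prod μ) = ∫ x, (∫ y, R (x, y) * b y ∂μ) * a x ∂μ := by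
  have := ha.1
  have := hb.1
  rw [integral_prod]
  · congr 1 with x
    rw [← integral_mul_const]
    congr 1 with y
    ring
  · exact integrable_of_abs_le (by fun_prop) C
      fun p => abs_mul_unit_le (hC p) (ha.2 _) (hb.2 _)

theorem integral_prod_unit_swap {R : Ω × Ω → ℝ} {C : ℝ} (hR : Measurable R)
    (hC : ∀ p, |R p| ≤ C) {a b : Ω → ℝ} (ha : UnitFun a) (hb : UnitFun b) :
    ∫ p, R p * (a p.1 * b p.2) ∂(μ.prod μ) = ∫ y, (∫ x, R (x, y) * a x ∂μ) * b y ∂μ := by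
  have := ha.1
  have := hb.1
  rw [integral_prod_symm]
  · congr 1 with x
    rw [← integral_mul_const]
    congr 1 with y
    ring
  · exact integrable_of_abs_le (by fun_prop) C
      fun p => abs_mul_unit_le (hC p) (ha.2 _) (hb.2 _)

theorem exists_signs_of_not_cutLE {R : Ω × Ω → ℝ} {C ε : ℝ} (hR : Measurable R)
    (hC : ∀ p, |R p| ≤ C) (h : ¬ CutLE μ R ε) :
    ∃ u v : Ω → ℝ, (Measurable u ∧ ∀ x, u x ∈ ({-1, 0, 1} : Set ℝ)) ∧
      (Measurable v ∧ ∀ x, v x ∈ ({-1, 0, 1} : Set ℝ)) ∧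
      ε ≤ ∫ p, R p * (u p.1 * v p.2) ∂(μ.prod μ) := by
  simp only [CutLE, not_forall, not_le] at h
  obtain ⟨a, b, ha, hb, h⟩ := h
  have hb1 := hb.1
  have h1 : ∀ x, |∫ y, R (x, y) * b y ∂μ| ≤ C := fun x =>
    abs_integral_le_of_abs_le fun y => by
      simpa using abs_mul_unit_le (hC (x, y)) (hb.2 y) (by simp : |(1 : ℝ)| ≤ 1)
  obtain ⟨u, hu, hu', hu2⟩ := exists_sign_integral_ge (μ := μ)
    (F := fun x => ∫ y, R (x, y) * b y ∂μ) (C := C)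
    (StronglyMeasurable.integral_prod_right
      (f := fun x y => R (x, y) * b y) (by fun_prop : Measurable _).stronglyMeasurable).measurable
    h1
  have hU := unitFun_of_mem_signs hu hu'
  have h2 : ∀ y, |∫ x, R (x, y) * u x ∂μ| ≤ C := fun y =>
    abs_integral_le_of_abs_le fun x => by
      simpa using abs_mul_unit_le (hC (x, y)) (hU.2 x) (by simp : |(1 : ℝ)| ≤ 1)
  obtain ⟨v, hv, hv', hv2⟩ := exists_sign_integral_ge (μ := μ)
    (F := fun y => ∫ x, R (x, y) * u x ∂μ) (C := C)
    (StronglyMeasurable.integral_prod_right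
      (f := fun y x => R (x, y) * u x) (by fun_prop : Measurable _).stronglyMeasurable).measurable
    h2
  have hV := unitFun_of_mem_signs hv hv'
  refine ⟨u, v, ⟨hu, hu'⟩, ⟨hv, hv'⟩, ?_⟩
  rw [integral_prod_unit_swap hR hC hU hV]
  refine le_trans ?_ (hv2 b hb)
  rw [← integral_prod_unit_swap hR hC hU hb, integral_prod_unit hR hC hU hb]
  refine le_trans ?_ (le_abs_self _)
  refine le_trans ?_ (hu2 a ha)
  rw [← integral_prod_unit hR hC ha hb]
  exact h.le

theorem exists_cut_approx_aux {D : Ω × Ω → ℝ} (hD : Measurable D) (hD1 : ∀ p, |D p| ≤ 1) {ε : ℝ}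
    (hε : 0 < ε) (N : ℕ) :
    ∃ u v : ℕ → Ω → ℝ, (∀ i, Measurable (u i) ∧ ∀ x, u i x ∈ ({-1, 0, 1} : Set ℝ)) ∧
      (∀ i, Measurable (v i) ∧ ∀ x, v i x ∈ ({-1, 0, 1} : Set ℝ)) ∧
      (CutLE μ (fun p => D p - ε * ∑ i ∈ Finset.range N, u i p.1 * v i p.2) ε ∨
        ∫ p, (D p - ε * ∑ i ∈ Finset.range N, u i p.1 * v i p.2) ^ 2 ∂(μ.prod μ)
          ≤ 1 - N * ε ^ 2) := by
  induction N with
  | zero =>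
    refine ⟨fun _ _ => 0, fun _ _ => 0, fun i => ⟨measurable_const, by simp⟩,
      fun i => ⟨measurable_const, by simp⟩, Or.inr ?_⟩
    have : |∫ p, (D p) ^ 2 ∂(μ.prod μ)| ≤ 1 := abs_integral_le_of_abs_le fun p => by
      rw [abs_pow]
      exact pow_le_one₀ (abs_nonneg _) (hD1 p)
    simpa using (abs_le.mp this).2
  | succ N ih =>
    obtain ⟨u, v, hu, hv, h⟩ := ih
    set R : Ω × Ω → ℝ := fun p => D p - ε * ∑ i ∈ Finset.range N, u i p.1 * v i p.2 with hR
    have hum : ∀ i, Measurable (u i) := fun i => (hu i).1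
    have hvm : ∀ i, Measurable (v i) := fun i => (hv i).1
    have hRm : Measurable R := by
      simp only [hR]
      fun_prop
    have hRC : ∀ p, |R p| ≤ 1 + ε * N := by
      intro p
      simp only [hR]
      refine (abs_sub _ _).trans (add_le_add (hD1 p) ?_)
      rw [abs_mul, abs_of_pos hε]
      gcongr
      refine (Finset.abs_sum_le_sum_abs _ _).trans ?_
      refine (Finset.sum_le_sum (g := fun _ => (1 : ℝ)) fun i _ => ?_).trans (by simp)
      rw [abs_mul]
      exact mul_le_one₀ ((unitFun_of_mem_signs (hum i) (hu i).2).2 _) (abs_nonneg _)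
        ((unitFun_of_mem_signs (hvm i) (hv i).2).2 _)
    by_cases hcut : CutLE μ R ε
    · refine ⟨fun i => if i < N then u i else 0, fun i => if i < N then v i else 0, fun i => ?_,
        fun i => ?_, Or.inl ?_⟩
      · by_cases hi : i < N
        · simpa [hi] using hu i
        · simp only [hi, if_false]
          exact ⟨measurable_zero, by simp⟩
      · by_cases hi : i < N
        · simpa [hi] using hv i
        · simp only [hi, if_false]
          exact ⟨measurable_zero, by simp⟩
      · convert hcut using 2 with p
        rw [hR, Finset.sum_range_succ]
        congr 2
        simp only [lt_self_iff_false, if_false, Pi.zero_apply, mul_zero, add_zero]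
        exact Finset.sum_congr rfl fun i hi => by simp [Finset.mem_range.mp hi]
    · have h := h.resolve_left hcut
      obtain ⟨a, b, ha, hb, hab⟩ := exists_signs_of_not_cutLE hRm hRC hcut
      have ham := ha.1
      have hbm := hb.1
      have hA := (unitFun_of_mem_signs ha.1 ha.2).2
      have hB := (unitFun_of_mem_signs hb.1 hb.2).2
      refine ⟨fun i => if i < N then u i else a, fun i => if i < N then v i else b, fun i => ?_,
        fun i => ?_, Or.inr ?_⟩
      · by_cases hi : i < N
        · simpa [hi] using hu i
        · simpa only [hi, if_false] using ha
      · by_cases hi : i < N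
        · simpa [hi] using hv i
        · simpa only [hi, if_false] using hb
      · have key : ∀ p : Ω × Ω, (D p - ε * ∑ i ∈ Finset.range (N + 1),
            (if i < N then u i else a) p.1 * (if i < N then v i else b) p.2) ^ 2
            ≤ R p ^ 2 - 2 * ε * (R p * (a p.1 * b p.2)) + ε ^ 2 := by
          intro p
          have hsum : ∑ i ∈ Finset.range (N + 1),
              (if i < N then u i else a) p.1 * (if i < N then v i else b) p.2
              = ∑ i ∈ Finset.range N, u i p.1 * v i p.2 + a p.1 * b p.2 := by
            rw [Finset.sum_range_succ]
            congr 1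
            · exact Finset.sum_congr rfl fun i hi => by simp [Finset.mem_range.mp hi]
            · simp
          rw [hsum, mul_add, ← sub_sub]
          change (R p - ε * (a p.1 * b p.2)) ^ 2 ≤ _
          have h1 : (a p.1 * b p.2) ^ 2 ≤ 1 := by
            rw [sq_le_one_iff_abs_le_one, abs_mul]
            exact mul_le_one₀ (hA _) (abs_nonneg _) (hB _)
          nlinarith [sq_nonneg ε]
        have hi1 : Integrable (fun p => R p ^ 2) (μ.prod μ) :=
          integrable_of_abs_le (by fun_prop) ((1 + ε * N) ^ 2) fun p => by
            rw [abs_pow]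
            gcongr
            exact hRC p
        have hi2 : Integrable (fun p => R p * (a p.1 * b p.2)) (μ.prod μ) :=
          integrable_of_abs_le (by fun_prop) (1 + ε * N)
            fun p => abs_mul_unit_le (hRC p) (hA _) (hB _)
        refine (integral_mono_of_nonneg (ae_of_all _ fun p => sq_nonneg _)
          ((hi1.sub (hi2.const_mul (2 * ε))).add (integrable_const (ε ^ 2)))
          (ae_of_all _ key)).trans ?_
        have : ∫ p, ((((fun p => R p ^ 2) - fun p => 2 * ε * (R p * (a p.1 * b p.2))) +
            fun _ => ε ^ 2) : Ω × Ω → ℝ) p ∂(μ.prod μ) = ∫ p, R p ^ 2 ∂(μ.prod μ)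
              - 2 * ε * ∫ p, R p * (a p.1 * b p.2) ∂(μ.prod μ) + ε ^ 2 := by
          rw [integral_add' (hi1.sub (hi2.const_mul (2 * ε))) (integrable_const _),
            integral_sub' hi1 (hi2.const_mul (2 * ε)), integral_const_mul]
          simp
        rw [this]
        push_cast
        nlinarith

/-- Weak regularity: a bounded kernel is `ε`-close in cut norm to a short combination of
rank one sign kernels. -/
theorem exists_cut_approx (μ : Measure Ω) [IsProbabilityMeasure μ] {D : Ω × Ω → ℝ}
    (hD : Measurable D) (hD1 : ∀ p, |D p| ≤ 1) {ε : ℝ} (hε : 0 < ε) {N : ℕ}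
    (hN : 1 < N * ε ^ 2) :
    ∃ u v : ℕ → Ω → ℝ, (∀ i, Measurable (u i) ∧ ∀ x, u i x ∈ ({-1, 0, 1} : Set ℝ)) ∧
      (∀ i, Measurable (v i) ∧ ∀ x, v i x ∈ ({-1, 0, 1} : Set ℝ)) ∧
      CutLE μ (fun p => D p - ε * ∑ i ∈ Finset.range N, u i p.1 * v i p.2) ε := by
  obtain ⟨u, v, hu, hv, h | h⟩ := exists_cut_approx_aux (μ := μ) hD hD1 hε N
  · exact ⟨u, v, hu, hv, h⟩
  · have : 0 ≤ ∫ p, (D p - ε * ∑ i ∈ Finset.range N, u i p.1 * v i p.2) ^ 2 ∂(μ.prod μ) :=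
      integral_nonneg fun p => sq_nonneg _
    linarith

/-- The triangle form of three kernels. -/
noncomputable def trip (μ : Measure Ω) (A B C : Ω × Ω → ℝ) : ℝ :=
  ∫ p : Ω × Ω × Ω, A (p.1, p.2.1) * B (p.2.1, p.2.2) * C (p.2.2, p.1) ∂(μ.prod (μ.prod μ))

theorem abs_mul_mul_le {x y z a b c : ℝ} (hx : |x| ≤ a) (hy : |y| ≤ b) (hz : |z| ≤ c) :
    |x * y * z| ≤ a * b * c := by
  rw [abs_mul, abs_mul]
  have := (abs_nonneg x).trans hx
  have := (abs_nonneg y).trans hy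
  gcongr

theorem trip_eq_iterated {A B C : Ω × Ω → ℝ} {a b c : ℝ} (hA : Measurable A) (hB : Measurable B)
    (hC : Measurable C) (hAa : ∀ p, |A p| ≤ a) (hBb : ∀ p, |B p| ≤ b) (hCc : ∀ p, |C p| ≤ c) :
    trip μ A B C = ∫ x, ∫ y, ∫ z, A (x, y) * B (y, z) * C (z, x) ∂μ ∂μ ∂μ := by
  rw [trip, integral_prod]
  · congr 1 with x
    rw [integral_prod]
    exact integrable_of_abs_le (by fun_prop) (a * b * c)
      fun p => abs_mul_mul_le (hAa _) (hBb _) (hCc _)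
  · exact integrable_of_abs_le (by fun_prop) (a * b * c)
      fun p => abs_mul_mul_le (hAa _) (hBb _) (hCc _)

theorem trip_eq_integral_prod {A B C : Ω × Ω → ℝ} {a b c : ℝ} (hA : Measurable A)
    (hB : Measurable B)
    (hC : Measurable C) (hAa : ∀ p, |A p| ≤ a) (hBb : ∀ p, |B p| ≤ b) (hCc : ∀ p, |C p| ≤ c) :
    trip μ A B C = ∫ z, ∫ p, A p * (C (z, p.1) * B (p.2, z)) ∂(μ.prod μ) ∂μ := by
  rw [trip, ← (measurePreserving_prodAssoc μ μ μ).integral_comp'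
    (f := MeasurableEquiv.prodAssoc), integral_prod_symm]
  · congr 1 with z
    congr 1 with p
    simp only [MeasurableEquiv.prodAssoc, MeasurableEquiv.coe_mk, Equiv.prodAssoc_apply]
    ring
  · exact integrable_of_abs_le (by fun_prop) (a * b * c)
      fun p => abs_mul_mul_le (hAa _) (hBb _) (hCc _)

theorem trip_rotate (A B C : Ω × Ω → ℝ) : trip μ A B C = trip μ B C A := by
  rw [trip, trip]
  symm
  rw [← (measurePreserving_prodAssoc μ μ μ).integral_comp' (f := MeasurableEquiv.prodAssoc),
    ← (Measure.measurePreserving_swap (μ := μ) (ν := μ.prod μ)).integral_comp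
      MeasurableEquiv.prodComm.measurableEmbedding]
  congr 1 with p
  simp only [MeasurableEquiv.prodAssoc, MeasurableEquiv.coe_mk, Equiv.prodAssoc_apply, Prod.swap]
  ring

theorem abs_trip_le {R A B : Ω × Ω → ℝ} {ε a b r : ℝ} (hR : Measurable R) (hA : Measurable A)
    (hB : Measurable B) (hr : ∀ p, |R p| ≤ r) (hAa : ∀ p, |A p| ≤ a) (hBb : ∀ p, |B p| ≤ b)
    (ha : 0 < a) (hb : 0 < b) (h : CutLE μ R ε) : |trip μ R A B| ≤ ε * a * b := by
  rw [trip_eq_integral_prod hR hA hB hr hAa hBb]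
  refine abs_integral_le_of_abs_le fun z => ?_
  have h1 := h (fun x => B (z, x) / b) (fun y => A (y, z) / a)
    ⟨by fun_prop, fun x => by rw [abs_div, abs_of_pos hb]; exact div_le_one_of_le₀ (hBb _) hb.le⟩
    ⟨by fun_prop, fun x => by rw [abs_div, abs_of_pos ha]; exact div_le_one_of_le₀ (hAa _) ha.le⟩
  have h2 : ∫ p, R p * (B (z, p.1) * A (p.2, z)) ∂(μ.prod μ)
      = (∫ p, R p * (B (z, p.1) / b * (A (p.2, z) / a)) ∂(μ.prod μ)) * (a * b) := by
    rw [← integral_mul_const]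
    congr 1 with p
    field_simp
  rw [h2, abs_mul, abs_of_pos (mul_pos ha hb), mul_assoc]
  gcongr

theorem trip_sub {A A' B C : Ω × Ω → ℝ} {a a' b c : ℝ} (hA : Measurable A) (hA' : Measurable A')
    (hB : Measurable B) (hC : Measurable C) (hAa : ∀ p, |A p| ≤ a) (hAa' : ∀ p, |A' p| ≤ a')
    (hBb : ∀ p, |B p| ≤ b) (hCc : ∀ p, |C p| ≤ c) :
    trip μ (fun p => A p - A' p) B C = trip μ A B C - trip μ A' B C := by
  rw [trip, trip, trip, ← integral_sub]
  · congr 1 with p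
    ring
  · exact integrable_of_abs_le (by fun_prop) (a * b * c)
      fun p => abs_mul_mul_le (hAa _) (hBb _) (hCc _)
  · exact integrable_of_abs_le (by fun_prop) (a' * b * c)
      fun p => abs_mul_mul_le (hAa' _) (hBb _) (hCc _)

theorem abs_trip_sub_le {W H K : Ω × Ω → ℝ} {ε δ r s : ℝ} (hW : Measurable W) (hH : Measurable H)
    (hK : Measurable K) (hW1 : ∀ p, |W p| ≤ 1) (hHr : ∀ p, |H p| ≤ r) (hKs : ∀ p, |K p| ≤ s)
    (hr : 0 < r) (h1 : CutLE μ (fun p => W p - H p) ε) (h2 : CutLE μ (fun p => W p - K p) δ) :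
    |trip μ W W W - trip μ H K W| ≤ ε + δ * r := by
  have e1 : trip μ W W W - trip μ H W W = trip μ (fun p => W p - H p) W W :=
    (trip_sub hW hH hW hW hW1 hHr hW1 hW1).symm
  have e2 : trip μ H W W - trip μ H K W = trip μ (fun p => W p - K p) W H := by
    rw [trip_sub hW hK hW hH hW1 hKs hW1 hHr, trip_rotate H, trip_rotate H]
  have b1 := abs_trip_le (μ := μ) (hW.sub hH) hW hW
    (fun p => (abs_sub _ _).trans (add_le_add (hW1 p) (hHr p))) hW1 hW1 one_pos one_pos h1
  have b2 := abs_trip_le (μ := μ) (hW.sub hK) hW hH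
    (fun p => (abs_sub _ _).trans (add_le_add (hW1 p) (hKs p))) hW1 hHr one_pos hr h2
  calc |trip μ W W W - trip μ H K W|
      = |(trip μ W W W - trip μ H W W) + (trip μ H W W - trip μ H K W)| := by ring_nf
    _ ≤ _ := abs_add_le _ _
    _ ≤ ε * 1 * 1 + δ * 1 * r := by
        rw [e1, e2]
        exact add_le_add b1 b2
    _ = _ := by ring

theorem abs_trip_diag_sub_le {A E : Ω × Ω → ℝ} {ε : ℝ} (hA : Measurable A) (hE : Measurable E)
    (hA1 : ∀ p, |A p| ≤ 1) (hE1 : ∀ p, |E p| ≤ 1) (h : CutLE μ (fun p => A p - E p) ε) :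
    |trip μ A A A - trip μ E E E| ≤ 3 * ε := by
  have h1 := abs_trip_sub_le hA hE hE hA1 hE1 hE1 one_pos h h
  have h2 := abs_trip_le (μ := μ) (hA.sub hE) hE hE
    (fun p => (abs_sub _ _).trans (add_le_add (hA1 p) (hE1 p))) hE1 hE1 one_pos one_pos h
  have e2 : trip μ E E A - trip μ E E E = trip μ (fun p => A p - E p) E E := by
    rw [trip_sub hA hE hE hE hA1 hE1 hE1 hE1, trip_rotate A E E]
  calc |trip μ A A A - trip μ E E E|
      = |(trip μ A A A - trip μ E E A) + (trip μ E E A - trip μ E E E)| := by ring_nf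
    _ ≤ _ := abs_add_le _ _
    _ ≤ (ε + ε * 1) + ε * 1 * 1 := by
        rw [e2]
        exact add_le_add h1 h2
    _ = _ := by ring

end Cut

section I0Facts

theorem I0_eq_binEntropy (u : ℝ) : I0 u = -(Real.binEntropy u) / 2 := by
  simp only [I0, Real.binEntropy, Real.log_inv]
  ring

theorem continuous_I0 : Continuous I0 := by
  rw [show I0 = fun u => -(Real.binEntropy u) / 2 from funext I0_eq_binEntropy]
  exact (Real.binEntropy_continuous.neg).div_const 2

theorem convexOn_I0 : ConvexOn ℝ (Icc 0 1) I0 := by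
  rw [show I0 = fun u => (1 / 2 : ℝ) • (-Real.binEntropy) u from funext fun u => by
    rw [I0_eq_binEntropy]; simp; ring]
  exact (Real.strictConcave_binEntropy.concaveOn.neg).smul (by norm_num)

theorem I0_nonpos {u : ℝ} (hu : u ∈ Icc (0 : ℝ) 1) : I0 u ≤ 0 := by
  rw [I0_eq_binEntropy]
  have := Real.binEntropy_nonneg hu.1 hu.2
  linarith

theorem neg_log_two_le_I0 (u : ℝ) : -(Real.log 2) / 2 ≤ I0 u := by
  rw [I0_eq_binEntropy]
  have := Real.binEntropy_le_log_two (p := u)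
  linarith

theorem abs_I0_le {u : ℝ} (hu : u ∈ Icc (0 : ℝ) 1) : |I0 u| ≤ 1 := by
  have h1 := I0_nonpos hu
  have h2 := neg_log_two_le_I0 u
  have h3 := Real.log_two_lt_d9
  rw [abs_le]
  constructor <;> linarith

end I0Facts

theorem abs_le_one_of_mem_Icc {u : ℝ} (hu : u ∈ Icc (0 : ℝ) 1) : |u| ≤ 1 := by
  rw [abs_le]; constructor <;> linarith [hu.1, hu.2]

/-- The barycentre of the conditional laws of the second coordinate. -/
theorem exists_barycenter {Y : Type*} [MeasurableSpace Y] (ν : Measure (Y × Icc (0 : ℝ) 1))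
    [IsProbabilityMeasure ν] :
    ∃ g : Y → ℝ, Measurable g ∧ (∀ y, g y ∈ Icc (0 : ℝ) 1) ∧
      (∀ f : Y → ℝ, Measurable f → (∃ C, ∀ y, |f y| ≤ C) →
        ∫ p, f p.1 * (p.2 : ℝ) ∂ν = ∫ y, f y * g y ∂ν.fst) ∧
      ∫ y, I0 (g y) ∂ν.fst ≤ ∫ p, I0 (p.2 : ℝ) ∂ν := by
  have : IsProbabilityMeasure ν.fst := inferInstance
  have hg : Measurable fun y => ∫ w, (w : ℝ) ∂ν.condKernel y :=
    (StronglyMeasurable.integral_kernel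
      (measurable_subtype_coe.stronglyMeasurable)).measurable
  have hgI : ∀ y, ∫ w, (w : ℝ) ∂ν.condKernel y ∈ Icc (0 : ℝ) 1 := fun y =>
    ⟨integral_nonneg fun w => w.2.1,
      (le_abs_self _).trans (abs_integral_le_of_abs_le fun w => abs_le_one_of_mem_Icc w.2)⟩
  refine ⟨fun y => ∫ w, (w : ℝ) ∂ν.condKernel y, hg, hgI, ?_, ?_⟩
  · rintro f hf ⟨C, hC⟩
    rw [← Measure.integral_condKernel]
    · simp_rw [integral_const_mul]
    · refine integrable_of_abs_le (by fun_prop) (C * 1) fun p => ?_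
      rw [abs_mul]
      exact mul_le_mul (hC _) (abs_le_one_of_mem_Icc p.2.2) (abs_nonneg _)
        ((abs_nonneg _).trans (hC p.1))
  · have hi : Integrable (fun p : Y × Icc (0 : ℝ) 1 => I0 (p.2 : ℝ)) ν :=
      integrable_of_abs_le (continuous_I0.measurable.comp (by fun_prop)) 1
        fun p => abs_I0_le p.2.2
    rw [← Measure.integral_condKernel hi]
    refine integral_mono (integrable_of_abs_le (continuous_I0.measurable.comp hg) 1
      fun y => abs_I0_le (hgI y)) hi.integral_condKernel fun y => ?_
    exact convexOn_I0.map_integral_le continuous_I0.continuousOn isClosed_Icc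
      (ae_of_all _ fun w => w.2)
      (integrable_of_abs_le (by fun_prop) 1 fun w => abs_le_one_of_mem_Icc w.2)
      (integrable_of_abs_le (continuous_I0.measurable.comp (by fun_prop)) 1
        fun w => abs_I0_le w.2)

theorem exists_symm_barycenter {X : Type*} [MeasurableSpace X] (m : Measure X)
    [IsProbabilityMeasure m] (ν : Measure ((X × X) × Icc (0 : ℝ) 1)) [IsProbabilityMeasure ν]
    (hfst : ν.fst = m.prod m) (hswap : ν.map (fun p => (p.1.swap, p.2)) = ν) :
    ∃ g : X × X → ℝ, Measurable g ∧ (∀ p, g p ∈ Icc (0 : ℝ) 1) ∧ (∀ p, g p.swap = g p) ∧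
      (∀ f : X × X → ℝ, Measurable f → (∃ C, ∀ p, |f p| ≤ C) →
        ∫ p, f p.1 * (p.2 : ℝ) ∂ν = ∫ p, f p * g p ∂(m.prod m)) ∧
      ∫ p, I0 (g p) ∂(m.prod m) ≤ ∫ p, I0 (p.2 : ℝ) ∂ν := by
  obtain ⟨g, hg, hgI, hf, hI⟩ := exists_barycenter ν
  rw [hfst] at hI
  have hgs : Measurable fun p : X × X => g p.swap := hg.comp measurable_swap
  have swap_int (f : X × X → ℝ) :
      ∫ p, f p.swap ∂(m.prod m) = ∫ p, f p ∂(m.prod m) :=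
    (Measure.measurePreserving_swap (μ := m) (ν := m)).integral_comp
      MeasurableEquiv.prodComm.measurableEmbedding f
  refine ⟨fun p => (g p + g p.swap) / 2, by fun_prop, fun p => ?_, fun p => ?_, ?_, ?_⟩
  · have h1 := hgI p
    have h2 := hgI p.swap
    constructor <;> linarith [h1.1, h1.2, h2.1, h2.2]
  · simp [add_comm]
  · rintro f hfm ⟨C, hC⟩
    have e1 := hf f hfm ⟨C, hC⟩
    have e2 := hf (fun p => f p.swap) (hfm.comp measurable_swap) ⟨C, fun p => hC _⟩
    have e3 : ∫ p, f p.1 * (p.2 : ℝ) ∂ν = ∫ p, f p.1.swap * (p.2 : ℝ) ∂ν := by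
      conv_lhs => rw [← hswap]
      rw [integral_map (by fun_prop)]
      exact (Measurable.aestronglyMeasurable (by fun_prop))
    have e4 := swap_int fun p => f p * g p.swap
    simp only [Prod.swap_swap] at e4
    have h_integrable (u : X × X → ℝ) (hu : Measurable u) (hu1 : ∀ p, u p ∈ Icc (0 : ℝ) 1) :
        Integrable (fun p => f p * u p) (m.prod m) := by
      refine integrable_of_abs_le (by fun_prop) (C * 1) fun p => ?_
      rw [abs_mul]
      exact mul_le_mul (hC _) (abs_le_one_of_mem_Icc (hu1 p)) (abs_nonneg _)
        ((abs_nonneg _).trans (hC p))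
    have e5 : ∫ p, f p * ((g p + g p.swap) / 2) ∂(m.prod m) =
        (∫ p, f p * g p ∂(m.prod m) + ∫ p, f p * g p.swap ∂(m.prod m)) / 2 := by
      rw [← integral_add (h_integrable g hg hgI) (h_integrable _ hgs fun p => hgI _), ← integral_div]
      congr 1 with p
      ring
    rw [hfst] at e1 e2
    linarith
  · have h_integrable (u : X × X → ℝ) (hu : Measurable u) (hu1 : ∀ p, u p ∈ Icc (0 : ℝ) 1) :
        Integrable (fun p => I0 (u p)) (m.prod m) :=
      integrable_of_abs_le (continuous_I0.measurable.comp hu) 1 fun p => abs_I0_le (hu1 p)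
    have e5 : ∫ p, I0 (g p) ∂(m.prod m) = 
        ∫ p, (I0 (g p) + I0 (g p.swap)) / 2 ∂(m.prod m) := by
      rw [integral_div, integral_add (h_integrable g hg hgI) (h_integrable _ hgs fun p => hgI _),
        swap_int fun p => I0 (g p)]
      ring
    refine le_trans ?_ hI
    rw [e5]
    refine integral_mono (h_integrable _ (by fun_prop) fun p => ?_)
      (((h_integrable g hg hgI).add (h_integrable _ hgs fun p => hgI _)).div_const 2) fun p => ?_
    · have h1 := hgI p
      have h2 := hgI p.swap
      constructor <;> linarith [h1.1, h1.2, h2.1, h2.2]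
    · have := convexOn_I0.2 (hgI p) (hgI p.swap) (by norm_num : (0 : ℝ) ≤ 1 / 2)
        (by norm_num : (0 : ℝ) ≤ 1 / 2) (by norm_num)
      simp only [smul_eq_mul] at this
      convert this using 1
      · ring_nf
      · ring

/-- Law of the features and the kernel value at a random pair of points. -/
noncomputable def kernelLaw {X Ω : Type*} [MeasurableSpace X] [MeasurableSpace Ω]
    (μ : Measure Ω) (φ : Ω → X)
    (W : Ω × Ω → Icc (0 : ℝ) 1) : Measure ((X × X) × Icc (0 : ℝ) 1) :=
  (μ.prod μ).map fun p => ((φ p.1, φ p.2), W p)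

theorem integral_kernelLaw {X Ω : Type*} [MeasurableSpace X] [MeasurableSpace Ω]
    {μ : Measure Ω} {φ : Ω → X}
    (hφ : Measurable φ) {W : Ω × Ω → Icc (0 : ℝ) 1} (hW : Measurable W)
    {F : (X × X) × Icc (0 : ℝ) 1 → ℝ} (hF : Measurable F) :
    ∫ q, F q ∂(kernelLaw μ φ W) = ∫ p, F ((φ p.1, φ p.2), W p) ∂(μ.prod μ) := by
  rw [kernelLaw, integral_map (by fun_prop) hF.aestronglyMeasurable]

section WeakLimit

variable {X : Type*} [TopologicalSpace X] [CompactSpace X] [PolishSpace X] [MeasurableSpace X]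
  [BorelSpace X]

theorem exists_kernel_limit {Ω : ℕ → Type*} [∀ k, MeasurableSpace (Ω k)]
    (μ : ∀ k, Measure (Ω k)) [∀ k, IsProbabilityMeasure (μ k)] (φ : ∀ k, Ω k → X)
    (hφ : ∀ k, Measurable (φ k)) (W : ∀ k, Ω k × Ω k → Icc (0 : ℝ) 1)
    (hW : ∀ k, Measurable (W k)) (hWs : ∀ k p, W k p.swap = W k p) :
    ∃ (s : ℕ → ℕ) (m : Measure X) (g : X × X → ℝ), StrictMono s ∧ IsProbabilityMeasure m ∧
      Measurable g ∧ (∀ p, g p ∈ Icc (0 : ℝ) 1) ∧ (∀ p, g p.swap = g p) ∧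
      (∀ f : C(X × X, ℝ), Tendsto
        (fun k => ∫ p, f (φ (s k) p.1, φ (s k) p.2) ∂((μ (s k)).prod (μ (s k)))) atTop
        (nhds (∫ p, f p ∂(m.prod m)))) ∧
      (∀ f : C(X × X, ℝ), Tendsto
        (fun k => ∫ p, f (φ (s k) p.1, φ (s k) p.2) * (W (s k) p : ℝ)
          ∂((μ (s k)).prod (μ (s k)))) atTop
        (nhds (∫ p, f p * g p ∂(m.prod m)))) ∧
      (∀ f h : C(X × X, ℝ), Tendsto
        (fun k => trip (μ (s k)) (fun p => f (φ (s k) p.1, φ (s k) p.2))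
          (fun p => h (φ (s k) p.1, φ (s k) p.2)) (fun p => (W (s k) p : ℝ))) atTop
        (nhds (trip m f h g))) ∧
      ∀ (r : ℕ → ℝ) (c : ℝ), Tendsto r atTop (nhds c) →
        (∀ k, ∫ p, I0 (W k p : ℝ) ∂((μ k).prod (μ k)) ≤ r k) →
        ∫ p, I0 (g p) ∂(m.prod m) ≤ c := by
  have hφ2 : ∀ k, Measurable fun p : Ω k × Ω k => ((φ k p.1, φ k p.2), W k p) := fun k => by
    have := hφ k
    have := hW k
    fun_prop
  let ν : ℕ → ProbabilityMeasure ((X × X) × Icc (0 : ℝ) 1) := fun k =>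
    ⟨kernelLaw (μ k) (φ k) (W k), Measure.isProbabilityMeasure_map (hφ2 k).aemeasurable⟩
  obtain ⟨ν', s, hs, hlim⟩ := CompactSpace.tendsto_subseq ν
  let mk : ℕ → ProbabilityMeasure X := fun k =>
    ⟨(μ k).map (φ k), Measure.isProbabilityMeasure_map (hφ k).aemeasurable⟩
  have hc1 : Continuous fun p : (X × X) × Icc (0 : ℝ) 1 => p.1.1 := by fun_prop
  have hmk : ∀ k, (ν k).map hc1.measurable.aemeasurable = mk k := fun k => by
    apply Subtype.ext
    change Measure.map _ (Measure.map _ _) = Measure.map _ _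
    rw [Measure.map_map hc1.measurable (hφ2 k)]
    have : (fun p : (X × X) × Icc (0 : ℝ) 1 => p.1.1) ∘ (fun p : Ω k × Ω k =>
        ((φ k p.1, φ k p.2), W k p)) = φ k ∘ Prod.fst := rfl
    rw [this, ← Measure.map_map (hφ k) measurable_fst]
    congr 1
    exact Measure.fst_prod
  let m : ProbabilityMeasure X := ν'.map hc1.measurable.aemeasurable
  have hm : Tendsto (fun k => mk (s k)) atTop (nhds m) := by
    have := ProbabilityMeasure.tendsto_map_of_tendsto_of_continuous _ _ hlim hc1
    refine this.congr fun k => hmk _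
  have hc2 : Continuous fun p : (X × X) × Icc (0 : ℝ) 1 => p.1 := by fun_prop
  have hmk2 : ∀ k, (ν k).map hc2.measurable.aemeasurable = (mk k).prod (mk k) := fun k => by
    apply Subtype.ext
    change Measure.map _ (Measure.map _ _) = (Measure.map _ _).prod (Measure.map _ _)
    rw [Measure.map_map hc2.measurable (hφ2 k), Measure.map_prod_map _ _ (hφ k) (hφ k)]
    rfl
  have hprod : Tendsto (fun k => (mk (s k)).prod (mk (s k))) atTop (nhds (m.prod m)) :=
    (ProbabilityMeasure.continuous_prod.tendsto (m, m)).comp (hm.prodMk_nhds hm)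
  have hfst : (ν' : Measure ((X × X) × Icc (0 : ℝ) 1)).fst = (m : Measure X).prod (m : Measure X) := by
    have h1 := ProbabilityMeasure.tendsto_map_of_tendsto_of_continuous _ _ hlim hc2
    have h2 := tendsto_nhds_unique (h1.congr fun k => hmk2 _) hprod
    exact congrArg Subtype.val h2
  have hc3 : Continuous fun p : (X × X) × Icc (0 : ℝ) 1 => (p.1.swap, p.2) := by fun_prop
  have hswap : (ν' : Measure ((X × X) × Icc (0 : ℝ) 1)).map (fun p => (p.1.swap, p.2)) = ν' := by
    have h1 := ProbabilityMeasure.tendsto_map_of_tendsto_of_continuous _ _ hlim hc3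
    have h3 : ∀ k, (ν k).map hc3.measurable.aemeasurable = ν k := fun k => by
      apply Subtype.ext
      change Measure.map _ (Measure.map _ _) = Measure.map _ _
      rw [Measure.map_map hc3.measurable (hφ2 k)]
      conv_rhs => rw [← Measure.prod_swap, Measure.map_map (hφ2 k) measurable_swap]
      congr 1
      funext p
      simp [hWs]
    have h2 := tendsto_nhds_unique (h1.congr fun k => h3 _) hlim
    exact congrArg Subtype.val h2
  obtain ⟨g, hg, hgI, hgs, hf, hI⟩ := exists_symm_barycenter (m : Measure X) ν' hfst hswap
  have hbd (f : C(X × X, ℝ)) : ∃ C, ∀ p, |f p| ≤ C := ⟨‖f‖, fun p => f.norm_coe_le_norm p⟩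
  refine ⟨s, m, g, hs, inferInstance, hg, hgI, hgs, fun f => ?_, fun f => ?_, fun f h => ?_,
    fun r c hr hrk => ?_⟩
  · have := ProbabilityMeasure.tendsto_iff_forall_integral_tendsto.1 hprod
      (BoundedContinuousFunction.mkOfCompact f)
    refine this.congr fun k => ?_
    change ∫ p, f p ∂((Measure.map _ _).prod (Measure.map _ _)) = _
    rw [Measure.map_prod_map _ _ (hφ _) (hφ _),
      integral_map ((hφ _).prodMap (hφ _)).aemeasurable
        f.continuous.measurable.aestronglyMeasurable]
    rfl
  · have := ProbabilityMeasure.tendsto_iff_forall_integral_tendsto.1 hlim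
      (BoundedContinuousFunction.mkOfCompact
        ⟨fun p => f p.1 * (p.2 : ℝ), by fun_prop⟩)
    obtain ⟨C, hC⟩ := hbd f
    have h2 := hf f f.continuous.measurable ⟨C, hC⟩
    rw [← h2]
    refine this.congr fun k => ?_
    exact integral_kernelLaw (hφ _) (hW _) (F := fun p => f p.1 * (p.2 : ℝ))
      (by have := f.continuous; fun_prop)
  · have hνm : Tendsto (fun k => (ν (s k)).prod (mk (s k))) atTop (nhds (ν'.prod m)) :=
      (ProbabilityMeasure.continuous_prod.tendsto (ν', m)).comp (hlim.prodMk_nhds hm)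
    obtain ⟨C, hC⟩ := hbd f
    obtain ⟨D, hD⟩ := hbd h
    have hfm := f.continuous.measurable
    have hhm := h.continuous.measurable
    let T : C(((X × X) × Icc (0 : ℝ) 1) × X, ℝ) :=
      ⟨fun q => (q.1.2 : ℝ) * (h (q.2, q.1.1.1) * f (q.1.1.2, q.2)), by fun_prop⟩
    have hT : Measurable T := T.continuous.measurable
    obtain ⟨K, hK⟩ : ∃ K, ∀ q, |T q| ≤ K :=
      ⟨‖T‖, fun q => T.norm_coe_le_norm q⟩
    have := ProbabilityMeasure.tendsto_iff_forall_integral_tendsto.1 hνm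
      (BoundedContinuousFunction.mkOfCompact T)
    have e1 : trip (m : Measure X) f h g =
        ∫ q, T q ∂((ν' : Measure ((X × X) × Icc (0 : ℝ) 1)).prod (m : Measure X)) := by
      rw [← trip_rotate, trip_eq_integral_prod hg hfm hhm
        (fun p => abs_le_one_of_mem_Icc (hgI p)) hC hD,
        integral_prod_symm _ (integrable_of_abs_le hT K hK)]
      congr 1 with z
      have := hf (fun p => h (z, p.1) * f (p.2, z)) (by fun_prop) ⟨D * C, fun p => by
        rw [abs_mul]
        exact mul_le_mul (hD _) (hC _) (abs_nonneg _) ((abs_nonneg _).trans (hD (z, p.1)))⟩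
      change _ = ∫ x : (X × X) × Icc (0 : ℝ) 1,
        (x.2 : ℝ) * (h (z, x.1.1) * f (x.1.2, z)) ∂(ν' : Measure ((X × X) × Icc (0 : ℝ) 1))
      simp_rw [mul_comm] at this ⊢
      exact this.symm
    rw [e1]
    refine this.congr fun k => ?_
    have := hφ (s k)
    have := hW (s k)
    rw [← trip_rotate, trip_eq_integral_prod (by fun_prop) (by fun_prop) (by fun_prop)
        (fun p => abs_le_one_of_mem_Icc (W (s k) p).2) (fun p => hC _) (fun p => hD _)]
    change ∫ q, T q ∂((kernelLaw (μ (s k)) (φ (s k)) (W (s k))).prod ((μ (s k)).map (φ (s k)))) = _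
    have : IsProbabilityMeasure (kernelLaw (μ (s k)) (φ (s k)) (W (s k))) := (ν (s k)).2
    have : IsProbabilityMeasure ((μ (s k)).map (φ (s k))) := (mk (s k)).2
    rw [integral_prod_symm _ (integrable_of_abs_le hT K hK), integral_map (hφ _).aemeasurable]
    · congr 1 with z
      rw [integral_kernelLaw (hφ _) (hW _) (by fun_prop)]
      rfl
    · refine AEStronglyMeasurable.integral_prod_right' (f := fun q => T q.swap) ?_
      exact (hT.comp measurable_swap).aestronglyMeasurable
  · refine hI.trans ?_
    have := ProbabilityMeasure.tendsto_iff_forall_integral_tendsto.1 hlim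
      (BoundedContinuousFunction.mkOfCompact
        ⟨fun p => I0 (p.2 : ℝ), continuous_I0.comp (by fun_prop)⟩)
    refine le_of_tendsto_of_tendsto' this (hr.comp hs.tendsto_atTop) fun k => ?_
    refine le_trans (le_of_eq ?_) (hrk (s k))
    exact integral_kernelLaw (hφ _) (hW _) (F := fun p => I0 (p.2 : ℝ))
      (continuous_I0.measurable.comp (by fun_prop))

end WeakLimit

section Extend

variable {X : Type*} [TopologicalSpace X] [CompactSpace X] [PolishSpace X] [MeasurableSpace X]
  [BorelSpace X]

theorem exists_continuous_approx (m : Measure X) [IsProbabilityMeasure m] {a : X → ℝ}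
    (ha : UnitFun a) {η : ℝ} (hη : 0 < η) :
    ∃ a' : C(X, ℝ), (∀ x, |a' x| ≤ 1) ∧ ∫ x, |a x - a' x| ∂m ≤ η := by
  obtain ⟨b, hb, -⟩ := (integrable_of_abs_le (μ := m) ha.1 1 ha.2)
    |>.exists_boundedContinuous_integral_sub_le hη
  have hbc := b.continuous
  refine ⟨⟨fun x => max (-1) (min 1 (b x)), by fun_prop⟩, fun x => ?_, le_trans ?_ hb⟩
  · rw [abs_le]
    exact ⟨le_max_left _ _, max_le (by norm_num) (min_le_left _ _)⟩
  · have h2 : ∀ x, |b x| ≤ ‖b‖ := b.norm_coe_le_norm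
    have hm := ha.1
    have hbm := hbc.measurable
    have hab : ∀ x, |a x| ≤ 1 := ha.2
    refine integral_mono (integrable_of_abs_le ?_ 2 fun x => ?_)
      (integrable_of_abs_le (by fun_prop) (1 + ‖b‖) fun x => ?_) fun x => ?_
    · change Measurable fun x => |a x - max (-1) (min 1 (b x))|
      fun_prop
    · have h3 : |max (-1) (min 1 (b x))| ≤ 1 := by
        rw [abs_le]
        exact ⟨le_max_left _ _, max_le (by norm_num) (min_le_left _ _)⟩
      rw [abs_abs]
      exact (abs_sub _ _).trans (by
        have := hab x
        change |a x| + |max (-1) (min 1 (b x))| ≤ 2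
        linarith)
    · rw [abs_of_nonneg (norm_nonneg _)]
      exact (norm_sub_le _ _).trans (add_le_add (hab x) (h2 x))
    · have e : a x = max (-1) (min 1 (a x)) := by
        have := abs_le.1 (hab x)
        rw [min_eq_right this.2, max_eq_right this.1]
      change |a x - max (-1) (min 1 (b x))| ≤ ‖a x - b x‖
      conv_lhs => rw [e]
      rw [Real.norm_eq_abs]
      refine (abs_max_sub_max_le_max _ _ _ _).trans ?_
      rw [sub_self, abs_zero]
      refine max_le (abs_nonneg _) ((abs_min_sub_min_le_max _ _ _ _).trans ?_)
      rw [sub_self, abs_zero]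
      exact max_le (abs_nonneg _) le_rfl

theorem cutLE_of_continuous {m : Measure X} [IsProbabilityMeasure m] {R : X × X → ℝ} {C ε : ℝ}
    (hR : Measurable R) (hC : ∀ p, |R p| ≤ C)
    (h : ∀ a b : C(X, ℝ), (∀ x, |a x| ≤ 1) → (∀ x, |b x| ≤ 1) →
      |∫ p, R p * (a p.1 * b p.2) ∂(m.prod m)| ≤ ε) : CutLE m R ε := by
  intro a b ha hb
  have hC0 : 0 ≤ C := by
    have : Nonempty X := nonempty_of_isProbabilityMeasure m
    exact (abs_nonneg _).trans (hC (Classical.arbitrary _))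
  refine le_of_forall_pos_le_add fun η hη => ?_
  have hη' : 0 < η / (2 * (C + 1)) := by positivity
  obtain ⟨a', ha', hae⟩ := exists_continuous_approx m ha hη'
  obtain ⟨b', hb', hbe⟩ := exists_continuous_approx m hb hη'
  have hma := ha.1
  have hmb := hb.1
  have hma' := a'.continuous.measurable
  have hmb' := b'.continuous.measurable
  have key : |∫ p, R p * (a p.1 * b p.2) ∂(m.prod m) - ∫ p, R p * (a' p.1 * b' p.2) ∂(m.prod m)|
      ≤ C * (∫ x, |a x - a' x| ∂m) + C * (∫ x, |b x - b' x| ∂m) := by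
    rw [← integral_sub (integrable_of_abs_le (by fun_prop) C
        fun p => abs_mul_unit_le (hC p) (ha.2 _) (hb.2 _))
      (integrable_of_abs_le (by fun_prop) C fun p => abs_mul_unit_le (hC p) (ha' _) (hb' _))]
    have i1 : ∫ p : X × X, |a p.1 - a' p.1| ∂(m.prod m) = ∫ x, |a x - a' x| ∂m := by
      rw [integral_fun_fst (fun x => |a x - a' x|)]; simp
    have i2 : ∫ p : X × X, |b p.2 - b' p.2| ∂(m.prod m) = ∫ x, |b x - b' x| ∂m := by
      rw [integral_fun_snd (fun x => |b x - b' x|)]; simp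
    have j1 : Integrable (fun p : X × X => |a p.1 - a' p.1|) (m.prod m) :=
      integrable_of_abs_le (by fun_prop) 2 fun p => by
        rw [abs_abs]
        exact (abs_sub _ _).trans (by linarith [ha.2 p.1, ha' p.1])
    have j2 : Integrable (fun p : X × X => |b p.2 - b' p.2|) (m.prod m) :=
      integrable_of_abs_le (by fun_prop) 2 fun p => by
        rw [abs_abs]
        exact (abs_sub _ _).trans (by linarith [hb.2 p.2, hb' p.2])
    rw [← i1, ← i2, ← integral_const_mul, ← integral_const_mul,
      ← integral_add (j1.const_mul C) (j2.const_mul C)]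
    refine (abs_integral_le_integral_abs).trans (integral_mono_of_nonneg
      (ae_of_all _ fun p => abs_nonneg _) ((j1.const_mul C).add (j2.const_mul C))
      (ae_of_all _ fun p => ?_))
    have e : R p * (a p.1 * b p.2) - R p * (a' p.1 * b' p.2) =
        R p * (a p.1 - a' p.1) * b p.2 + R p * a' p.1 * (b p.2 - b' p.2) := by ring
    simp only [e]
    refine (abs_add_le _ _).trans (add_le_add ?_ ?_)
    · rw [abs_mul, abs_mul]
      calc |R p| * |a p.1 - a' p.1| * |b p.2| ≤ C * |a p.1 - a' p.1| * 1 := by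
            gcongr
            · exact hC p
            · exact hb.2 _
        _ = _ := mul_one _
    · rw [abs_mul, abs_mul]
      calc |R p| * |a' p.1| * |b p.2 - b' p.2| ≤ C * 1 * |b p.2 - b' p.2| := by
            gcongr
            · exact hC p
            · exact ha' _
        _ = _ := by rw [mul_one]
  have h1 := h a' b' ha' hb'
  have h2 : C * (∫ x, |a x - a' x| ∂m) + C * (∫ x, |b x - b' x| ∂m) ≤ η := by
    calc _ ≤ (C + 1) * (η / (2 * (C + 1))) + (C + 1) * (η / (2 * (C + 1))) := by
          gcongr <;> linarith
      _ = η := by field_simp; norm_num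
  have h3 := abs_sub_abs_le_abs_sub (∫ p, R p * (a p.1 * b p.2) ∂(m.prod m))
    (∫ p, R p * (a' p.1 * b' p.2) ∂(m.prod m))
  linarith

end Extend

section Features

/-- The compact space of feature sequences. -/
abbrev Feat : Type := ℕ × ℕ → Icc (-1 : ℝ) 1 × Icc (-1 : ℝ) 1

/-- The `j`-th cut approximation read off from features. -/
noncomputable def featKernel (j : ℕ) : C(Feat × Feat, ℝ) where
  toFun p := (1 / ((j : ℝ) + 1)) * ∑ i ∈ Finset.range ((j + 1) ^ 2 + 1),
    ((p.1 (j, i)).1 : ℝ) * ((p.2 (j, i)).2 : ℝ)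
  continuous_toFun := by fun_prop

theorem exists_features {Ω : Type*} [MeasurableSpace Ω] (μ : Measure Ω) [IsProbabilityMeasure μ]
    {W : Ω × Ω → ℝ} (hW : Measurable W) (hW1 : ∀ p, |W p| ≤ 1) :
    ∃ φ : Ω → Feat, Measurable φ ∧
      ∀ j, CutLE μ (fun p => W p - featKernel j (φ p.1, φ p.2)) (1 / ((j : ℝ) + 1)) := by
  have h : ∀ j : ℕ, _ := fun j => exists_cut_approx μ hW hW1 (ε := 1 / ((j : ℝ) + 1))
    (N := (j + 1) ^ 2 + 1) (by positivity) (by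
      push_cast
      field_simp
      linarith)
  choose u v hu hv huv using h
  have mem {x : ℝ} (hx : x ∈ ({-1, 0, 1} : Set ℝ)) : x ∈ Icc (-1 : ℝ) 1 := by
    rcases hx with h | h | h <;> simp_all
  refine ⟨fun x q => (⟨u q.1 q.2 x, mem ((hu _ _).2 x)⟩, ⟨v q.1 q.2 x, mem ((hv _ _).2 x)⟩),
    ?_, fun j => ?_⟩
  · refine measurable_pi_lambda _ fun q => ?_
    exact ((hu q.1 q.2).1.subtype_mk).prodMk ((hv q.1 q.2).1.subtype_mk)
  · exact huv j

end Features

section Limit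

/-- Kernels with convergent edge, triangle and rate integrals have a limit kernel. -/
theorem exists_limit_kernel {Ω : ℕ → Type*} [∀ k, MeasurableSpace (Ω k)]
    (μ : ∀ k, Measure (Ω k)) [∀ k, IsProbabilityMeasure (μ k)] (W : ∀ k, Ω k × Ω k → ℝ)
    (hW : ∀ k, Measurable (W k)) (hW1 : ∀ k p, W k p ∈ Icc (0 : ℝ) 1)
    (hWs : ∀ k p, W k p.swap = W k p) (r : ℕ → ℝ) {e t c : ℝ}
    (he : Tendsto (fun k => ∫ p, W k p ∂((μ k).prod (μ k))) atTop (nhds e))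
    (ht : Tendsto (fun k => trip (μ k) (W k) (W k) (W k)) atTop (nhds t))
    (hr : Tendsto r atTop (nhds c))
    (hWr : ∀ k, ∫ p, I0 (W k p) ∂((μ k).prod (μ k)) ≤ r k) :
    ∃ (m : Measure Feat) (g : Feat × Feat → ℝ), IsProbabilityMeasure m ∧
      Measurable g ∧ (∀ p, g p ∈ Icc (0 : ℝ) 1) ∧ (∀ p, g p.swap = g p) ∧
      ∫ p, g p ∂(m.prod m) = e ∧ trip m g g g = t ∧ ∫ p, I0 (g p) ∂(m.prod m) ≤ c := by
  choose φ hφ hcut using fun k => exists_features (μ k) (hW k)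
    fun p => abs_le_one_of_mem_Icc (hW1 k p)
  obtain ⟨s, m, g, hs, hm, hg, hg1, hgs, hl1, hl2, hl3, hl4⟩ := exists_kernel_limit μ φ hφ
    (fun k p => ⟨W k p, hW1 k p⟩) (fun k => (hW k).subtype_mk)
    (fun k p => Subtype.ext (hWs k p))
  dsimp only at hl2 hl3 hl4
  have hgm : ∀ p, |g p| ≤ 1 := fun p => abs_le_one_of_mem_Icc (hg1 p)
  have hWm : ∀ k p, |W k p| ≤ 1 := fun k p => abs_le_one_of_mem_Icc (hW1 k p)
  have hHm : ∀ j, Measurable (featKernel j) := fun j => (featKernel j).continuous.measurable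
  have hHb : ∀ j p, |featKernel j p| ≤ ‖featKernel j‖ + 1 := fun j p =>
    ((featKernel j).norm_coe_le_norm p).trans (by linarith)
  have hHφ : ∀ j k, Measurable fun p : Ω k × Ω k => featKernel j (φ k p.1, φ k p.2) :=
    fun j k => by
      have := hφ k
      exact (hHm j).comp (by fun_prop)
  have hcutg : ∀ j : ℕ, CutLE m (fun p => g p - featKernel j p) (1 / ((j : ℝ) + 1)) := by
    intro j
    refine cutLE_of_continuous (C := 1 + (‖featKernel j‖ + 1)) (hg.sub (hHm j))
      (fun p => (abs_sub _ _).trans (add_le_add (hgm p) (hHb j p))) fun a b ha hb => ?_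
    have hac := a.continuous
    have hbc := b.continuous
    have t1 := hl2 ⟨fun p => a p.1 * b p.2, by fun_prop⟩
    have t2 := hl1 ⟨fun p => featKernel j p * (a p.1 * b p.2), by fun_prop⟩
    simp only [ContinuousMap.coe_mk] at t1 t2
    have hab : ∀ p : Feat × Feat, |a p.1 * b p.2| ≤ 1 := fun p => by
      rw [abs_mul]
      exact mul_le_one₀ (ha _) (abs_nonneg _) (hb _)
    have e1 : ∫ p, (g p - featKernel j p) * (a p.1 * b p.2) ∂(m.prod m) =
        ∫ p, (a p.1 * b p.2) * g p ∂(m.prod m) -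
          ∫ p, featKernel j p * (a p.1 * b p.2) ∂(m.prod m) := by
      have ham := hac.measurable
      have hbm := hbc.measurable
      have := hHm j
      rw [← integral_sub]
      · congr 1 with p
        ring
      · refine integrable_of_abs_le (by fun_prop) (1 * 1) fun p => ?_
        rw [abs_mul]
        exact mul_le_mul (hab p) (hgm p) (abs_nonneg _) zero_le_one
      · exact integrable_of_abs_le (by fun_prop) _ fun p =>
          abs_mul_unit_le (hHb j p) (ha _) (hb _)
    rw [e1]
    refine le_of_tendsto' (t1.sub t2).abs fun k => ?_
    have hak : UnitFun fun x => a (φ (s k) x) := ⟨hac.measurable.comp (hφ _), fun x => ha _⟩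
    have hbk : UnitFun fun x => b (φ (s k) x) := ⟨hbc.measurable.comp (hφ _), fun x => hb _⟩
    refine le_trans (le_of_eq ?_) (hcut (s k) j _ _ hak hbk)
    congr 1
    have h1 := hak.1
    have h2 := hbk.1
    have h3 := hHφ j (s k)
    have h4 := hW (s k)
    rw [← integral_sub]
    · congr 1 with p
      ring
    · refine integrable_of_abs_le (by fun_prop) (1 * 1) fun p => ?_
      rw [abs_mul]
      exact mul_le_mul (hab (φ (s k) p.1, φ (s k) p.2)) (hWm _ p) (abs_nonneg _) zero_le_one
    · exact integrable_of_abs_le (by fun_prop) _ fun p =>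
        abs_mul_unit_le (hHb j _) (ha _) (hb _)
  refine ⟨m, g, hm, hg, hg1, hgs, ?_, ?_, hl4 r c hr hWr⟩
  · have t1 := hl2 (ContinuousMap.const _ 1)
    simp only [ContinuousMap.const_apply, one_mul] at t1
    exact tendsto_nhds_unique t1 (he.comp hs.tendsto_atTop)
  · have key : ∀ j l : ℕ, |trip m g g g - t| ≤
        2 * (1 / ((j : ℝ) + 1) + 1 / ((l : ℝ) + 1) * (‖featKernel j‖ + 1)) := by
      intro j l
      have b1 := abs_trip_sub_le hg (hHm j) (hHm l) hgm (hHb j) (hHb l) (by positivity)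
        (hcutg j) (hcutg l)
      have b2 : |t - trip m (featKernel j) (featKernel l) g| ≤
          1 / ((j : ℝ) + 1) + 1 / ((l : ℝ) + 1) * (‖featKernel j‖ + 1) := by
        refine le_of_tendsto' ((ht.comp hs.tendsto_atTop).sub
          (hl3 (featKernel j) (featKernel l))).abs fun k => ?_
        exact abs_trip_sub_le (hW _) (hHφ j _) (hHφ l _) (hWm _) (fun p => hHb j _)
          (fun p => hHb l _) (by positivity) (hcut _ j) (hcut _ l)
      have := abs_sub_le (trip m g g g) (trip m (featKernel j) (featKernel l) g) t
      rw [abs_sub_comm t] at b2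
      linarith
    have hz : Tendsto (fun j : ℕ => 1 / ((j : ℝ) + 1)) atTop (nhds 0) :=
      tendsto_one_div_add_atTop_nhds_zero_nat
    have k1 : ∀ j : ℕ, |trip m g g g - t| ≤ 2 * (1 / ((j : ℝ) + 1)) := fun j => by
      have : Tendsto (fun l : ℕ => 2 * (1 / ((j : ℝ) + 1) +
          1 / ((l : ℝ) + 1) * (‖featKernel j‖ + 1))) atTop
          (nhds (2 * (1 / ((j : ℝ) + 1) + 0 * (‖featKernel j‖ + 1)))) :=
        ((hz.mul_const _).const_add _).const_mul _
      rw [zero_mul, add_zero] at this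
      exact ge_of_tendsto' this (key j)
    have k2 : |trip m g g g - t| ≤ 2 * 0 := ge_of_tendsto' (hz.const_mul 2) k1
    have := abs_nonpos_iff.1 (k2.trans (by simp))
    linarith

instance isProbabilityMeasure_unitMeasure : IsProbabilityMeasure unitMeasure :=
  ⟨by simp [unitMeasure]⟩

theorem edgeDensity_eq_integral_prod {g : ℝ → ℝ → ℝ} (hg : IsGraphon g) :
    edgeDensity g = ∫ p, g p.1 p.2 ∂(unitMeasure.prod unitMeasure) := by
  have hm := hg.1
  rw [integral_prod (fun p : ℝ × ℝ => g p.1 p.2)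
    (integrable_of_abs_le hm 1 fun p => abs_le_one_of_mem_Icc (hg.2.2 _ _))]
  rfl

theorem rate_eq_integral_prod {g : ℝ → ℝ → ℝ} (hg : IsGraphon g) :
    rate g = ∫ p, I0 (g p.1 p.2) ∂(unitMeasure.prod unitMeasure) := by
  have hm : Measurable fun p : ℝ × ℝ => I0 (g p.1 p.2) := continuous_I0.measurable.comp hg.1
  rw [integral_prod _ (integrable_of_abs_le hm 1 fun p => abs_I0_le (hg.2.2 _ _))]
  rfl

theorem triangleDensity_eq_trip {g : ℝ → ℝ → ℝ} (hg : IsGraphon g) :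
    triangleDensity g = trip unitMeasure (Function.uncurry g) (Function.uncurry g)
      (Function.uncurry g) := by
  have h1 : ∀ p, |Function.uncurry g p| ≤ 1 := fun p => abs_le_one_of_mem_Icc (hg.2.2 _ _)
  rw [trip_eq_iterated hg.1 hg.1 hg.1 h1 h1 h1]
  rfl

/-- Kernels with convergent edge, triangle and rate integrals have a limit graphon. -/
theorem exists_graphon_limit {Ω : ℕ → Type*} [∀ k, MeasurableSpace (Ω k)]
    (μ : ∀ k, Measure (Ω k)) [∀ k, IsProbabilityMeasure (μ k)] (W : ∀ k, Ω k × Ω k → ℝ)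
    (hW : ∀ k, Measurable (W k)) (hW1 : ∀ k p, W k p ∈ Icc (0 : ℝ) 1)
    (hWs : ∀ k p, W k p.swap = W k p) (r : ℕ → ℝ) {e t c : ℝ}
    (he : Tendsto (fun k => ∫ p, W k p ∂((μ k).prod (μ k))) atTop (nhds e))
    (ht : Tendsto (fun k => trip (μ k) (W k) (W k) (W k)) atTop (nhds t))
    (hr : Tendsto r atTop (nhds c))
    (hWr : ∀ k, ∫ p, I0 (W k p) ∂((μ k).prod (μ k)) ≤ r k) :
    ∃ g, IsGraphon g ∧ edgeDensity g = e ∧ triangleDensity g = t ∧ rate g ≤ c := by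
  obtain ⟨m, g, hm, hg, hg1, hgs, rfl, rfl, hc⟩ :=
    exists_limit_kernel μ W hW hW1 hWs r he ht hr hWr
  have : Nonempty Feat := nonempty_of_isProbabilityMeasure m
  obtain ⟨f, hf, hfm⟩ := MeasureTheory.Measure.exists_measurable_map_eq m
  have hψ : MeasurePreserving (fun x : ℝ => f (projIcc 0 1 zero_le_one x)) unitMeasure m := by
    have hmeas : Measurable fun x : ℝ => f (projIcc 0 1 zero_le_one x) :=
      hf.comp continuous_projIcc.measurable
    refine ⟨hmeas, ?_⟩
    have h1 := unitInterval.measurePreserving_coe.map_eq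
    change _ = unitMeasure at h1
    rw [← h1, Measure.map_map hmeas measurable_subtype_coe]
    refine Eq.trans ?_ hfm
    congr 1
    funext x
    simp
  have hG : IsGraphon fun x y =>
      g (f (projIcc 0 1 zero_le_one x), f (projIcc 0 1 zero_le_one y)) := by
    refine ⟨hg.comp (hψ.measurable.prodMap hψ.measurable), fun x y => ?_, fun x y => hg1 _⟩
    exact (hgs _).symm
  have h2 := hψ.prod hψ
  have h3 := hψ.prod h2
  have int2 (F : Feat × Feat → ℝ) (hF : Measurable F) :
      ∫ p, F (Prod.map (fun x : ℝ => f (projIcc 0 1 zero_le_one x))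
        (fun x : ℝ => f (projIcc 0 1 zero_le_one x)) p) ∂(unitMeasure.prod unitMeasure) =
      ∫ p, F p ∂(m.prod m) := by
    rw [← h2.map_eq, integral_map h2.measurable.aemeasurable hF.aestronglyMeasurable]
  refine ⟨_, hG, ?_, ?_, ?_⟩
  · rw [edgeDensity_eq_integral_prod hG]
    exact int2 g hg
  · rw [triangleDensity_eq_trip hG, trip, trip, ← h3.map_eq,
      integral_map h3.measurable.aemeasurable (Measurable.aestronglyMeasurable (by fun_prop))]
    rfl
  · rw [rate_eq_integral_prod hG]
    exact (int2 (fun p => I0 (g p)) (continuous_I0.measurable.comp hg)).trans_le hc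

end Limit

section Weights

/-- The potential edges on `n` vertices. -/
abbrev EdgeSlot (n : ℕ) : Type := {s : Sym2 (Fin n) // ¬ s.IsDiag}

variable {n : ℕ}

open Classical in
/-- Graphs as Boolean configurations on the potential edges. -/
noncomputable def graphEquivBool (n : ℕ) : SimpleGraph (Fin n) ≃ (EdgeSlot n → Bool) where
  toFun G s := @decide (s.1 ∈ G.edgeSet) (Classical.propDecidable _)
  invFun f := SimpleGraph.fromEdgeSet {s | ∃ h, f ⟨s, h⟩ = true}
  left_inv G := by
    refine (congrArg SimpleGraph.fromEdgeSet (Set.ext fun s => ?_)).trans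
      (SimpleGraph.fromEdgeSet_edgeSet G)
    simpa using fun h => G.not_isDiag_of_mem_edgeSet h
  right_inv f := by
    funext s
    have := s.2
    refine Bool.eq_iff_iff.2 ((@decide_eq_true_iff _ (Classical.propDecidable _)).trans ?_)
    simp [this]

open Classical in
/-- Probability of `G` when each potential edge `s` is present independently with
probability `p s`. -/
noncomputable def graphWeight (p : Sym2 (Fin n) → ℝ) (G : SimpleGraph (Fin n)) : ℝ :=
  ∏ s : EdgeSlot n, if s.1 ∈ G.edgeSet then p s.1 else 1 - p s.1

open Classical in
theorem sum_graph_prod (a b : EdgeSlot n → ℝ) :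
    ∑ G : SimpleGraph (Fin n), ∏ s : EdgeSlot n, (if s.1 ∈ G.edgeSet then a s else b s) =
      ∏ s, (a s + b s) := by
  have := Fintype.prod_sum fun s (i : Bool) => if i then a s else b s
  simp only [Fintype.sum_bool, if_true, Bool.false_eq_true, if_false] at this
  rw [this, ← (graphEquivBool n).sum_comp]
  simp [graphEquivBool]

theorem sum_graphWeight (p : Sym2 (Fin n) → ℝ) : ∑ G, graphWeight p G = 1 := by
  have := sum_graph_prod (n := n) (fun s => p s.1) fun s => 1 - p s.1
  simpa [graphWeight] using this

theorem graphWeight_nonneg {p : Sym2 (Fin n) → ℝ} (hp : ∀ s, p s ∈ Icc (0 : ℝ) 1)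
    (G : SimpleGraph (Fin n)) : 0 ≤ graphWeight p G := by
  refine Finset.prod_nonneg fun s _ => ?_
  have := hp s.1
  split_ifs <;> linarith [this.1, this.2]

open Classical in
theorem sum_graphWeight_mul_prod (p : Sym2 (Fin n) → ℝ) (S : Finset (Sym2 (Fin n)))
    (hS : ∀ s ∈ S, ¬ s.IsDiag) :
    ∑ G, graphWeight p G * ∏ s ∈ S, (if s ∈ G.edgeSet then 1 else 0) = ∏ s ∈ S, p s := by
  have h2 (u : Sym2 (Fin n) → ℝ) :
      ∏ s : EdgeSlot n, (if s.1 ∈ S then u s.1 else 1) = ∏ s ∈ S, u s := by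
    rw [Finset.prod_ite, Finset.prod_const_one, mul_one]
    refine Finset.prod_bij (fun s _ => s.1) (by simp) (fun a _ b _ => Subtype.ext)
      (fun s hs => ⟨⟨s, hS s hs⟩, by simpa using hs, rfl⟩) (fun _ _ => rfl)
  rw [← h2]
  refine Eq.trans (Finset.sum_congr rfl fun G _ => ?_) ((sum_graph_prod
    (fun s : EdgeSlot n => p s.1) (fun s => if s.1 ∈ S then 0 else 1 - p s.1)).trans ?_)
  · rw [graphWeight, ← h2, ← Finset.prod_mul_distrib]
    refine Finset.prod_congr rfl fun s _ => ?_
    split_ifs <;> simp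
  · refine Finset.prod_congr rfl fun s _ => ?_
    split_ifs <;> simp

theorem sum_graphWeight_mul_log (p : Sym2 (Fin n) → ℝ) :
    ∑ G, graphWeight p G * Real.log (graphWeight p G) =
      ∑ s : EdgeSlot n, 2 * I0 (p s.1) := by
  classical
  have key : ∀ G, graphWeight p G * Real.log (graphWeight p G) =
      ∑ s : EdgeSlot n, graphWeight p G *
        Real.log (if s.1 ∈ G.edgeSet then p s.1 else 1 - p s.1) := by
    intro G
    by_cases h : graphWeight p G = 0
    · simp [h]
    · rw [← Finset.mul_sum, ← Real.log_prod]
      · rfl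
      · intro s hs h0
        exact h (Finset.prod_eq_zero hs h0)
  simp_rw [key]
  rw [Finset.sum_comm]
  refine Finset.sum_congr rfl fun s _ => ?_
  refine Eq.trans (Finset.sum_congr rfl fun G _ => ?_) ((sum_graph_prod
    (fun s' : EdgeSlot n => p s'.1 * if s' = s then Real.log (p s'.1) else 1)
    (fun s' => (1 - p s'.1) * if s' = s then Real.log (1 - p s'.1) else 1)).trans ?_)
  · have : Real.log (if s.1 ∈ G.edgeSet then p s.1 else 1 - p s.1) = ∏ s' : EdgeSlot n,
        if s' = s then Real.log (if s'.1 ∈ G.edgeSet then p s'.1 else 1 - p s'.1) else 1 := by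
      rw [Finset.prod_ite_eq']
      simp
    rw [this, graphWeight, ← Finset.prod_mul_distrib]
    refine Finset.prod_congr rfl fun s _ => ?_
    split_ifs <;> simp
  · rw [Finset.prod_eq_single s]
    · simp only [I0, if_true]
      ring
    · intro b _ hb
      simp [hb]
    · simp

theorem two_mul_sum_edgeSlot (F : Sym2 (Fin n) → ℝ) :
    2 * ∑ s : EdgeSlot n, F s.1 = ∑ i, ∑ j, if i = j then 0 else F s(i, j) := by
  have h1 : ∑ s : EdgeSlot n, F s.1 = ∑ i : Fin n, ∑ j, if i < j then F s(i, j) else 0 := by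
    have := Finset.sum_sym2_filter_not_isDiag (Finset.univ : Finset (Fin n)) F
    rw [Finset.sym2_univ, Finset.sum_subtype _ (p := fun s => ¬ s.IsDiag) (by simp)] at this
    rw [this, ← Fintype.sum_prod_type', ← Finset.sum_filter]
    refine Finset.sum_congr (Finset.ext fun p => ?_) fun _ _ => rfl
    simpa using fun h => h.ne
  have h2 : ∑ i : Fin n, ∑ j, (if i < j then F s(i, j) else 0) =
      ∑ i : Fin n, ∑ j, if j < i then F s(i, j) else 0 := by
    rw [Finset.sum_comm]
    simp_rw [Sym2.eq_swap]
  rw [two_mul]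
  nth_rewrite 2 [h1]
  rw [h2, h1, ← Finset.sum_add_distrib]
  refine Finset.sum_congr rfl fun i _ => ?_
  rw [← Finset.sum_add_distrib]
  refine Finset.sum_congr rfl fun j _ => ?_
  rcases lt_trichotomy i j with h | h | h
  · simp [h, h.ne, h.not_gt]
  · simp [h]
  · simp [h, h.ne', h.not_gt]

end Weights

section Patterns

theorem measurePreserving_comp_injective {V ι α : Type*} [Fintype V] [Fintype ι]
    [MeasurableSpace α] (μ : Measure α) [IsProbabilityMeasure μ] {c : V → ι}
    (hc : Function.Injective c) :
    MeasurePreserving (fun x : ι → α => x ∘ c) (Measure.pi fun _ => μ) (Measure.pi fun _ => μ) := by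
  classical
  have hm : Measurable fun x : ι → α => x ∘ c :=
    measurable_pi_lambda _ fun v => measurable_pi_apply (c v)
  refine ⟨hm, (Measure.pi_eq fun s hs => ?_).symm⟩
  rw [Measure.map_apply hm (MeasurableSet.univ_pi hs)]
  have e : (fun x : ι → α => x ∘ c) ⁻¹' (Set.univ.pi s) =
      Set.univ.pi fun i => if h : ∃ v, c v = i then s h.choose else Set.univ := by
    ext x
    simp only [Set.mem_preimage, Set.mem_pi, Set.mem_univ, true_imp_iff, Function.comp]
    constructor
    · intro h i
      split_ifs with hi
      · have := h hi.choose
        rwa [hi.choose_spec] at this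
      · trivial
    · intro h v
      have hv : ∃ w, c w = c v := ⟨v, rfl⟩
      have := h (c v)
      rw [dif_pos hv, hc hv.choose_spec] at this
      exact this
  rw [e, Measure.pi_pi]
  have h1 : ∏ v, μ (s v) = ∏ i ∈ Finset.univ.image c,
      μ (if h : ∃ v, c v = i then s h.choose else Set.univ) := by
    rw [Finset.prod_image hc.injOn]
    refine Finset.prod_congr rfl fun v _ => ?_
    have hv : ∃ w, c w = c v := ⟨v, rfl⟩
    rw [dif_pos hv, hc hv.choose_spec]
  rw [h1]
  symm
  refine Finset.prod_subset (Finset.subset_univ _) fun i _ hi => ?_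
  rw [dif_neg (by simpa using hi), measure_univ]

/-- Average of `∏ w (c a) (c b)` over the edges `(a, b)` of the pattern `E` and all maps `c`. -/
noncomputable def homDensity {V : Type*} [Fintype V] (E : Finset (V × V)) {n : ℕ}
    (w : Fin n × Fin n → ℝ) : ℝ := by
  classical
  exact (∑ c : V → Fin n, ∏ p ∈ E, w (c p.1, c p.2)) / (n : ℝ) ^ Fintype.card V

/-- Density of the pattern `E` in a kernel on `[0,1]`. -/
noncomputable def patternDensity {V : Type*} [Fintype V] (E : Finset (V × V))
    (g : ℝ → ℝ → ℝ) : ℝ :=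
  ∫ y : V → ℝ, ∏ p ∈ E, g (y p.1) (y p.2) ∂(Measure.pi fun _ => unitMeasure)

/-- No loops and no antiparallel edges. -/
def IsOriented {V : Type*} (E : Finset (V × V)) : Prop :=
  (∀ p ∈ E, p.1 ≠ p.2) ∧ ∀ p ∈ E, p.swap ∉ E

open Classical in
/-- Adjacency kernel of a graph. -/
noncomputable def adjKernel {n : ℕ} (G : SimpleGraph (Fin n)) (p : Fin n × Fin n) : ℝ :=
  if G.Adj p.1 p.2 then 1 else 0

theorem adjKernel_mem {n : ℕ} (G : SimpleGraph (Fin n)) (p : Fin n × Fin n) :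
    adjKernel G p ∈ Icc (0 : ℝ) 1 := by
  unfold adjKernel
  split_ifs <;> simp

theorem adjKernel_swap {n : ℕ} (G : SimpleGraph (Fin n)) (p : Fin n × Fin n) :
    adjKernel G p.swap = adjKernel G p := by
  simp only [adjKernel, Prod.fst_swap, Prod.snd_swap]
  by_cases h : G.Adj p.1 p.2
  · rw [if_pos h, if_pos h.symm]
  · rw [if_neg h, if_neg fun hs => h hs.symm]

/-- Edge probabilities obtained by sampling a graphon at the points `x`. -/
def sampleProb {g : ℝ → ℝ → ℝ} (hg : IsGraphon g) {n : ℕ} (x : Fin n → ℝ) : Sym2 (Fin n) → ℝ :=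
  Sym2.lift ⟨fun i j => g (x i) (x j), fun _ _ => hg.2.1 _ _⟩

theorem sampleProb_mem {g : ℝ → ℝ → ℝ} (hg : IsGraphon g) {n : ℕ} (x : Fin n → ℝ)
    (s : Sym2 (Fin n)) : sampleProb hg x s ∈ Icc (0 : ℝ) 1 :=
  s.inductionOn fun _ _ => hg.2.2 _ _

theorem measurable_sampleProb {g : ℝ → ℝ → ℝ} (hg : IsGraphon g) {n : ℕ} (s : Sym2 (Fin n)) :
    Measurable fun x => sampleProb hg x s :=
  s.inductionOn fun i j => hg.1.comp (by fun_prop : Measurable fun x : Fin n → ℝ => (x i, x j))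

theorem measurable_graphWeight {g : ℝ → ℝ → ℝ} (hg : IsGraphon g) {n : ℕ}
    (G : SimpleGraph (Fin n)) : Measurable fun x => graphWeight (sampleProb hg x) G := by
  unfold graphWeight
  refine Finset.measurable_prod _ fun s _ => ?_
  have := measurable_sampleProb hg s.1
  split_ifs <;> fun_prop

theorem graphWeight_le_one {n : ℕ} {p : Sym2 (Fin n) → ℝ} (hp : ∀ s, p s ∈ Icc (0 : ℝ) 1)
    (G : SimpleGraph (Fin n)) : graphWeight p G ≤ 1 := by
  rw [← sum_graphWeight p]
  exact Finset.single_le_sum (fun G _ => graphWeight_nonneg hp G) (Finset.mem_univ G)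

theorem integrable_graphWeight {g : ℝ → ℝ → ℝ} (hg : IsGraphon g) {n : ℕ}
    (G : SimpleGraph (Fin n)) :
    Integrable (fun x => graphWeight (sampleProb hg x) G) (Measure.pi fun _ => unitMeasure) :=
  integrable_of_abs_le (measurable_graphWeight hg G) 1 fun x => by
    rw [abs_of_nonneg (graphWeight_nonneg (sampleProb_mem hg x) G)]
    exact graphWeight_le_one (sampleProb_mem hg x) G

/-- Probability of a graph under sampling from a graphon. -/
noncomputable def sampleWeight {g : ℝ → ℝ → ℝ} (hg : IsGraphon g) {n : ℕ}
    (G : SimpleGraph (Fin n)) : ℝ :=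
  ∫ x, graphWeight (sampleProb hg x) G ∂(Measure.pi fun _ => unitMeasure)

theorem sampleWeight_nonneg {g : ℝ → ℝ → ℝ} (hg : IsGraphon g) {n : ℕ}
    (G : SimpleGraph (Fin n)) : 0 ≤ sampleWeight hg G :=
  integral_nonneg fun x => graphWeight_nonneg (sampleProb_mem hg x) G

theorem sum_sampleWeight_mul {g : ℝ → ℝ → ℝ} (hg : IsGraphon g) {n : ℕ}
    (Φ : SimpleGraph (Fin n) → ℝ) : ∑ G, sampleWeight hg G * Φ G =
      ∫ x, ∑ G, graphWeight (sampleProb hg x) G * Φ G ∂(Measure.pi fun _ => unitMeasure) := by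
  rw [integral_finsetSum _ fun G _ => (integrable_graphWeight hg G).mul_const _]
  simp_rw [integral_mul_const]
  rfl

theorem sum_sampleWeight {g : ℝ → ℝ → ℝ} (hg : IsGraphon g) {n : ℕ} :
    ∑ G : SimpleGraph (Fin n), sampleWeight hg G = 1 := by
  have := sum_sampleWeight_mul hg (n := n) fun _ => 1
  simpa [sum_graphWeight] using this

theorem sum_sampleWeight_mul_prod {g : ℝ → ℝ → ℝ} (hg : IsGraphon g) {V : Type*} [Fintype V]
    {E : Finset (V × V)} (hE : IsOriented E) {n : ℕ} {c : V → Fin n}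
    (hc : Function.Injective c) :
    ∑ G, sampleWeight hg G * ∏ p ∈ E, adjKernel G (c p.1, c p.2) = patternDensity E g := by
  classical
  have hinj : Set.InjOn (fun p : V × V => s(c p.1, c p.2)) E := by
    intro p hp q hq h
    rcases Sym2.eq_iff.1 h with ⟨h1, h2⟩ | ⟨h1, h2⟩
    · exact Prod.ext (hc h1) (hc h2)
    · exact absurd (by rwa [show q.swap = p from Prod.ext (hc h1).symm (hc h2).symm])
        (hE.2 q hq)
  rw [sum_sampleWeight_mul, patternDensity,
    ← (measurePreserving_comp_injective unitMeasure hc).map_eq, integral_map]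
  · congr 1 with x
    have := sum_graphWeight_mul_prod (sampleProb hg x)
      (E.image fun p : V × V => s(c p.1, c p.2)) (by
        intro s hs
        obtain ⟨p, hp, rfl⟩ := Finset.mem_image.1 hs
        simpa using fun h => hE.1 p hp (hc h))
    simp only [Finset.prod_image hinj] at this
    refine Eq.trans (Finset.sum_congr rfl fun G _ => ?_) this
    congr 1
  · exact (measurePreserving_comp_injective unitMeasure hc).measurable.aemeasurable
  · refine (Finset.measurable_prod _ fun p _ => ?_).aestronglyMeasurable
    exact hg.1.comp (by fun_prop : Measurable fun y : V → ℝ => (y p.1, y p.2))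

theorem patternDensity_mem {g : ℝ → ℝ → ℝ} (hg : IsGraphon g) {V : Type*} [Fintype V]
    (E : Finset (V × V)) : patternDensity E g ∈ Icc (0 : ℝ) 1 := by
  refine ⟨integral_nonneg fun y => Finset.prod_nonneg fun p _ => (hg.2.2 _ _).1,
    (le_abs_self _).trans (abs_integral_le_of_abs_le fun y => ?_)⟩
  rw [Finset.abs_prod]
  exact Finset.prod_le_one (fun _ _ => abs_nonneg _)
    fun p _ => abs_le_one_of_mem_Icc (hg.2.2 _ _)

theorem one_sub_descFactorial_div_pow_le (k : ℕ) {n : ℕ} (hn : 0 < n) :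
    1 - (n.descFactorial k : ℝ) / (n : ℝ) ^ k ≤ (k : ℝ) ^ 2 / n := by
  have hn' : (0 : ℝ) < n := by exact_mod_cast hn
  rcases le_or_gt k n with h | h
  · have h2 : ((n : ℝ) + 1 - k) ^ k ≤ n.descFactorial k := by
      have := Nat.pow_sub_le_descFactorial n k
      have h3 : (((n + 1 - k) ^ k : ℕ) : ℝ) ≤ n.descFactorial k := by exact_mod_cast this
      rw [Nat.cast_pow, Nat.cast_sub (by omega)] at h3
      simpa using h3
    have hkn : (k : ℝ) ≤ n := by exact_mod_cast h
    have h4 := one_add_mul_le_pow (a := (1 - (k : ℝ)) / n) (by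
      rw [le_div_iff₀ hn']
      linarith) k
    have h5 : (1 + (1 - (k : ℝ)) / n) ^ k = ((n : ℝ) + 1 - k) ^ k / (n : ℝ) ^ k := by
      rw [← div_pow]
      congr 1
      field_simp
      ring
    have h6 : (k : ℝ) * ((1 - k) / n) = k / n - k ^ 2 / n := by
      field_simp
    have h7 : ((n : ℝ) + 1 - k) ^ k / (n : ℝ) ^ k ≤ n.descFactorial k / (n : ℝ) ^ k := by gcongr
    have h8 : (0 : ℝ) ≤ k / n := by positivity
    linarith
  · have h2 : (0 : ℝ) ≤ (n.descFactorial k : ℝ) / (n : ℝ) ^ k := by positivity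
    have hkn : (n : ℝ) < k := by exact_mod_cast h
    have hk1 : (1 : ℝ) ≤ k := by
      have : 1 ≤ k := by omega
      exact_mod_cast this
    have h3 : 1 ≤ (k : ℝ) ^ 2 / n := by
      rw [le_div_iff₀ hn']
      nlinarith
    linarith

theorem card_not_injective_le (V : Type*) [Fintype V] {n : ℕ} (hn : 0 < n) :
    (Nat.card {c : V → Fin n // ¬ Function.Injective c} : ℝ) / (n : ℝ) ^ Fintype.card V ≤
      (Fintype.card V : ℝ) ^ 2 / n := by
  classical
  set k := Fintype.card V with hk
  have hn' : (0 : ℝ) < n := by exact_mod_cast hn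
  have h1 : (Nat.card {c : V → Fin n // ¬ Function.Injective c} : ℝ) =
      (n : ℝ) ^ k - n.descFactorial k := by
    rw [Nat.card_eq_fintype_card, Fintype.card_subtype_compl,
      ← Fintype.card_congr (Equiv.subtypeInjectiveEquivEmbedding V (Fin n)).symm,
      Fintype.card_embedding_eq, Nat.cast_sub]
    · simp [hk]
    · simpa [hk] using Nat.descFactorial_le_pow n k
  rw [h1, sub_div, div_self (by positivity)]
  exact one_sub_descFactorial_div_pow_le k hn

theorem abs_sum_sampleWeight_homDensity_sub_le {g : ℝ → ℝ → ℝ} (hg : IsGraphon g) {V : Type*}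
    [Fintype V] {E : Finset (V × V)} (hE : IsOriented E) {n : ℕ} (hn : 0 < n) :
    |∑ G : SimpleGraph (Fin n), sampleWeight hg G * homDensity E (adjKernel G) -
      patternDensity E g| ≤ (Fintype.card V : ℝ) ^ 2 / n := by
  classical
  refine le_trans ?_ (card_not_injective_le V hn)
  have hpos : (0 : ℝ) < (n : ℝ) ^ Fintype.card V := by positivity
  let τ : (V → Fin n) → ℝ := fun c =>
    ∑ G, sampleWeight hg G * ∏ p ∈ E, adjKernel G (c p.1, c p.2)
  have h1 : ∑ G : SimpleGraph (Fin n), sampleWeight hg G * homDensity E (adjKernel G) =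
      (∑ c, τ c) / (n : ℝ) ^ Fintype.card V := by
    simp only [homDensity, τ]
    rw [Finset.sum_comm, Finset.sum_div]
    refine Finset.sum_congr rfl fun G _ => ?_
    rw [← Finset.mul_sum, mul_div_assoc]
  have h2 : patternDensity E g = (∑ c : V → Fin n, patternDensity E g) /
      (n : ℝ) ^ Fintype.card V := by
    simp [hpos.ne']
  rw [h1, h2, ← sub_div, ← Finset.sum_sub_distrib, abs_div, abs_of_pos hpos]
  gcongr
  have hτ : ∀ c, τ c ∈ Icc (0 : ℝ) 1 := by
    intro c
    have hp : ∀ G : SimpleGraph (Fin n), ∏ p ∈ E, adjKernel G (c p.1, c p.2) ∈ Icc (0 : ℝ) 1 :=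
      fun G => ⟨Finset.prod_nonneg fun p _ => (adjKernel_mem G _).1,
        Finset.prod_le_one (fun p _ => (adjKernel_mem G _).1) fun p _ => (adjKernel_mem G _).2⟩
    refine ⟨Finset.sum_nonneg fun G _ => mul_nonneg (sampleWeight_nonneg hg G) (hp G).1, ?_⟩
    rw [← sum_sampleWeight hg (n := n)]
    exact Finset.sum_le_sum fun G _ => mul_le_of_le_one_right (sampleWeight_nonneg hg G) (hp G).2
  have ht := patternDensity_mem hg E
  calc |∑ c, (τ c - patternDensity E g)| ≤ ∑ c, |τ c - patternDensity E g| :=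
        Finset.abs_sum_le_sum_abs _ _
    _ ≤ ∑ c : V → Fin n, if ¬ Function.Injective c then (1 : ℝ) else 0 := by
        refine Finset.sum_le_sum fun c _ => ?_
        split_ifs with h
        · have : τ c = patternDensity E g := sum_sampleWeight_mul_prod hg hE h
          simp [this]
        · rw [abs_le]
          constructor <;> linarith [(hτ c).1, (hτ c).2, ht.1, ht.2]
    _ = _ := by
        rw [Finset.sum_boole, Nat.card_eq_fintype_card, Fintype.card_subtype]

/-- Two disjoint copies of a pattern. -/
noncomputable def doublePattern {V : Type*} (E : Finset (V × V)) :
    Finset ((V ⊕ V) × (V ⊕ V)) := by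
  classical
  exact E.image (fun p => (Sum.inl p.1, Sum.inl p.2)) ∪
    E.image fun p => (Sum.inr p.1, Sum.inr p.2)

theorem IsOriented.double {V : Type*} {E : Finset (V × V)} (hE : IsOriented E) :
    IsOriented (doublePattern E) := by
  classical
  constructor
  · intro p hp
    simp only [doublePattern, Finset.mem_union, Finset.mem_image] at hp
    rcases hp with ⟨q, hq, rfl⟩ | ⟨q, hq, rfl⟩ <;> simpa using hE.1 q hq
  · intro p hp
    simp only [doublePattern, Finset.mem_union, Finset.mem_image] at hp
    rcases hp with ⟨q, hq, rfl⟩ | ⟨q, hq, rfl⟩ <;>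
      simpa [doublePattern, Prod.swap] using hE.2 q hq

theorem prod_doublePattern {V : Type*} (E : Finset (V × V)) (w : (V ⊕ V) × (V ⊕ V) → ℝ) :
    ∏ p ∈ doublePattern E, w p = (∏ p ∈ E, w (Sum.inl p.1, Sum.inl p.2)) *
      ∏ p ∈ E, w (Sum.inr p.1, Sum.inr p.2) := by
  classical
  rw [doublePattern, Finset.prod_union, Finset.prod_image, Finset.prod_image]
  · intro p _ q _ h
    simpa [Prod.ext_iff] using h
  · intro p _ q _ h
    simpa [Prod.ext_iff] using h
  · rw [Finset.disjoint_left]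
    intro p hp hq
    simp only [Finset.mem_image] at hp hq
    obtain ⟨a, -, rfl⟩ := hp
    obtain ⟨b, -, hb⟩ := hq
    simp at hb

theorem homDensity_double {V : Type*} [Fintype V] (E : Finset (V × V)) {n : ℕ}
    (w : Fin n × Fin n → ℝ) : homDensity (doublePattern E) w = homDensity E w ^ 2 := by
  classical
  unfold homDensity
  rw [div_pow, ← pow_mul, Fintype.card_sum, mul_two]
  congr 1
  simp_rw [prod_doublePattern E fun p => w _]
  rw [sq, Finset.sum_mul_sum, ← Fintype.sum_prod_type']
  convert! Fintype.sum_equiv (Equiv.sumArrowEquivProdArrow V V (Fin n)) _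
    (fun q => (∏ p ∈ E, w (q.1 p.1, q.1 p.2)) * ∏ p ∈ E, w (q.2 p.1, q.2 p.2))
    fun _ => rfl

theorem patternDensity_double {V : Type*} [Fintype V] (E : Finset (V × V)) (g : ℝ → ℝ → ℝ) :
    patternDensity (doublePattern E) g = patternDensity E g ^ 2 := by
  unfold patternDensity
  simp_rw [fun y : V ⊕ V → ℝ => prod_doublePattern E fun p => g (y p.1) (y p.2)]
  have hm := measurePreserving_sumPiEquivProdPi fun _ : V ⊕ V => unitMeasure
  rw [sq, ← integral_prod_mul (fun y : V → ℝ => ∏ p ∈ E, g (y p.1) (y p.2))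
    (fun y : V → ℝ => ∏ p ∈ E, g (y p.1) (y p.2)),
    ← hm.integral_comp (MeasurableEquiv.measurableEmbedding _)]
  rfl

end Patterns

section Concentration

theorem sum_sampleWeight_mul_sq_le {g : ℝ → ℝ → ℝ} (hg : IsGraphon g) {V : Type*}
    [Fintype V] {E : Finset (V × V)} (hE : IsOriented E) {n : ℕ} (hn : 0 < n) :
    ∑ G : SimpleGraph (Fin n), sampleWeight hg G *
      (homDensity E (adjKernel G) - patternDensity E g) ^ 2 ≤
      6 * (Fintype.card V : ℝ) ^ 2 / n := by
  have h1 := abs_le.1 (abs_sum_sampleWeight_homDensity_sub_le hg hE hn)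
  have h2 := abs_le.1 (abs_sum_sampleWeight_homDensity_sub_le hg hE.double hn)
  have h3 := patternDensity_mem hg E
  have h4 := sum_sampleWeight hg (n := n)
  simp only [homDensity_double, patternDensity_double, Fintype.card_sum, Nat.cast_add] at h2
  set t := patternDensity E g
  have h5 : ∑ G : SimpleGraph (Fin n), sampleWeight hg G *
      (homDensity E (adjKernel G) - t) ^ 2 =
      ∑ G : SimpleGraph (Fin n), sampleWeight hg G * homDensity E (adjKernel G) ^ 2 -
      2 * t * ∑ G : SimpleGraph (Fin n), sampleWeight hg G * homDensity E (adjKernel G) +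
      t ^ 2 * ∑ G : SimpleGraph (Fin n), sampleWeight hg G := by
    rw [Finset.mul_sum, Finset.mul_sum, ← Finset.sum_sub_distrib, ← Finset.sum_add_distrib]
    exact Finset.sum_congr rfl fun G _ => by ring
  rw [h5, h4]
  set m := ∑ G : SimpleGraph (Fin n), sampleWeight hg G * homDensity E (adjKernel G)
  set r := (Fintype.card V : ℝ) ^ 2 / n with hr
  have hr0 : 0 ≤ r := by positivity
  have e1 : ((Fintype.card V : ℝ) + Fintype.card V) ^ 2 / n = 4 * r := by rw [hr]; ring
  have e2 : 6 * (Fintype.card V : ℝ) ^ 2 / n = 6 * r := by rw [hr]; ring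
  rw [e1] at h2
  rw [e2]
  nlinarith [h3.1, h3.2]

theorem sum_mul_indicator_le {α : Type*} [Fintype α] {q f : α → ℝ} (hq : ∀ a, 0 ≤ q a)
    {δ C : ℝ} (hδ : 0 < δ) (hC : ∑ a, q a * f a ^ 2 ≤ C) (s : Finset α)
    (hs : ∀ a ∈ s, δ ≤ |f a|) : ∑ a ∈ s, q a ≤ C / δ ^ 2 := by
  rw [le_div_iff₀ (by positivity), Finset.sum_mul]
  refine le_trans ?_ hC
  refine (Finset.sum_le_sum fun a ha => ?_).trans
    (Finset.sum_le_univ_sum_of_nonneg fun a => mul_nonneg (hq a) (sq_nonneg _))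
  refine mul_le_mul_of_nonneg_left ?_ (hq a)
  rw [← sq_abs (f a)]
  have := hs a ha
  gcongr

theorem neg_sum_mul_log_le_cross {α : Type*} [Fintype α] {q r : α → ℝ} (hq : ∀ a, 0 ≤ q a)
    (hq1 : ∑ a, q a = 1) (hr : ∀ a, 0 < r a) (hr1 : ∑ a, r a ≤ 1) :
    - ∑ a, q a * log (q a) ≤ - ∑ a, q a * log (r a) := by
  have : ∑ a, q a * log (r a) - ∑ a, q a * log (q a) ≤ ∑ a, r a - ∑ a, q a := by
    rw [← Finset.sum_sub_distrib, ← Finset.sum_sub_distrib]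
    refine Finset.sum_le_sum fun a _ => ?_
    rcases (hq a).eq_or_lt with h | h
    · rw [← h]
      simpa using (hr a).le
    · have h1 := log_le_sub_one_of_pos (div_pos (hr a) h)
      rw [log_div (hr a).ne' h.ne'] at h1
      have h2 := mul_le_mul_of_nonneg_left h1 h.le
      have h3 : q a * (r a / q a - 1) = r a - q a := by field_simp
      linarith
  linarith

/-- Entropy is controlled by the cardinality of a set and the mass of its complement. -/
theorem neg_sum_mul_log_le {α : Type*} [Fintype α] [DecidableEq α] {q : α → ℝ}
    (hq : ∀ a, 0 ≤ q a) (hq1 : ∑ a, q a = 1) (A : Finset α) :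
    - ∑ a, q a * log (q a) ≤
      log 2 + log A.card + (∑ a ∈ Aᶜ, q a) * log (Fintype.card α) := by
  have hne : Nonempty α := by
    by_contra h
    rw [not_nonempty_iff] at h
    simp at hq1
  have hF : (0 : ℝ) < Fintype.card α := by exact_mod_cast Fintype.card_pos
  have hlA : 0 ≤ log (A.card : ℝ) := log_natCast_nonneg _
  let r : α → ℝ := fun a => (if a ∈ A then ((A.card : ℝ))⁻¹ / 2 else 0) + (Fintype.card α : ℝ)⁻¹ / 2
  have hr : ∀ a, 0 < r a := fun a => by
    have : (0 : ℝ) < (Fintype.card α : ℝ)⁻¹ / 2 := by positivity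
    simp only [r]
    split_ifs <;> positivity
  have hr1 : ∑ a, r a ≤ 1 := by
    simp only [r, Finset.sum_add_distrib, Finset.sum_ite_mem, Finset.univ_inter, Finset.sum_const,
      nsmul_eq_mul, Finset.card_univ]
    have h1 : (A.card : ℝ) * ((A.card : ℝ)⁻¹ / 2) ≤ 1 / 2 := by
      rw [← mul_div_assoc]
      gcongr
      exact mul_inv_le_one
    have h2 : (Fintype.card α : ℝ) * ((Fintype.card α : ℝ)⁻¹ / 2) = 1 / 2 := by field_simp
    linarith
  refine (neg_sum_mul_log_le_cross hq hq1 hr hr1).trans ?_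
  rw [← Finset.sum_neg_distrib, ← Finset.sum_add_sum_compl A, Finset.sum_mul]
  have hA : ∀ a ∈ A, -(q a * log (r a)) ≤ q a * (log 2 + log A.card) := by
    intro a ha
    have hc : (0 : ℝ) < A.card := by exact_mod_cast Finset.card_pos.2 ⟨a, ha⟩
    have h1 : (A.card : ℝ)⁻¹ / 2 ≤ r a := by
      simp only [r, if_pos ha]
      have : (0 : ℝ) ≤ (Fintype.card α : ℝ)⁻¹ / 2 := by positivity
      linarith
    have h2 := log_le_log (by positivity) h1
    rw [log_div (by positivity) (by positivity), log_inv] at h2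
    rw [← mul_neg]
    exact mul_le_mul_of_nonneg_left (by linarith) (hq a)
  have hB : ∀ a ∈ Aᶜ, -(q a * log (r a)) ≤ q a * (log 2 + log (Fintype.card α)) := by
    intro a ha
    have h1 : r a = (Fintype.card α : ℝ)⁻¹ / 2 := by
      simp only [r, if_neg (Finset.mem_compl.1 ha), zero_add]
    rw [h1, log_div (by positivity) (by positivity), log_inv, ← mul_neg]
    exact mul_le_mul_of_nonneg_left (by linarith) (hq a)
  have h2 : ∑ a ∈ A, q a ≤ 1 := by
    rw [← hq1]
    exact Finset.sum_le_univ_sum_of_nonneg hq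
  have h3 := Finset.sum_add_sum_compl A q
  rw [hq1] at h3
  have h4 := Finset.sum_le_sum hA
  have h5 := Finset.sum_le_sum hB
  rw [← Finset.sum_mul] at h4 h5
  rw [← Finset.sum_mul]
  nlinarith [log_pos one_lt_two]

theorem measurePreserving_vecTwo (μ : Measure ℝ) [IsProbabilityMeasure μ] :
    MeasurePreserving (fun p : ℝ × ℝ => ![p.1, p.2]) (μ.prod μ) (Measure.pi fun _ => μ) := by
  have hm : Measurable fun p : ℝ × ℝ => ![p.1, p.2] := by
    refine measurable_pi_lambda _ fun i => ?_
    fin_cases i <;> simp <;> fun_prop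
  refine ⟨hm, (Measure.pi_eq fun s hs => ?_).symm⟩
  rw [Measure.map_apply hm (MeasurableSet.univ_pi hs)]
  have : (fun p : ℝ × ℝ => ![p.1, p.2]) ⁻¹' (Set.univ.pi s) = s 0 ×ˢ s 1 := by
    ext p
    simp [Fin.forall_fin_two]
  rw [this, Measure.prod_prod, Fin.prod_univ_two]

theorem measurePreserving_vecThree (μ : Measure ℝ) [IsProbabilityMeasure μ] :
    MeasurePreserving (fun p : ℝ × ℝ × ℝ => ![p.1, p.2.1, p.2.2]) (μ.prod (μ.prod μ))
      (Measure.pi fun _ => μ) := by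
  have hm : Measurable fun p : ℝ × ℝ × ℝ => ![p.1, p.2.1, p.2.2] := by
    refine measurable_pi_lambda _ fun i => ?_
    fin_cases i <;> simp <;> fun_prop
  refine ⟨hm, (Measure.pi_eq fun s hs => ?_).symm⟩
  rw [Measure.map_apply hm (MeasurableSet.univ_pi hs)]
  have : (fun p : ℝ × ℝ × ℝ => ![p.1, p.2.1, p.2.2]) ⁻¹' (Set.univ.pi s) =
      s 0 ×ˢ (s 1 ×ˢ s 2) := by
    ext p
    simp [Fin.forall_fin_succ]
  rw [this, Measure.prod_prod, Measure.prod_prod, Fin.prod_univ_three, mul_assoc]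

/-- A single edge. -/
def edgePattern : Finset (Fin 2 × Fin 2) := {(0, 1)}

/-- A cyclically oriented triangle. -/
def trianglePattern : Finset (Fin 3 × Fin 3) := {(0, 1), (1, 2), (2, 0)}

theorem isOriented_edgePattern : IsOriented edgePattern := by
  unfold IsOriented edgePattern
  decide

theorem isOriented_trianglePattern : IsOriented trianglePattern := by
  unfold IsOriented trianglePattern
  decide

theorem prod_edgePattern (f : Fin 2 × Fin 2 → ℝ) : ∏ p ∈ edgePattern, f p = f (0, 1) := by
  simp [edgePattern]

theorem prod_trianglePattern (f : Fin 3 × Fin 3 → ℝ) :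
    ∏ p ∈ trianglePattern, f p = f (0, 1) * f (1, 2) * f (2, 0) := by
  simp [trianglePattern, mul_assoc]

theorem patternDensity_edgePattern {g : ℝ → ℝ → ℝ} (hg : IsGraphon g) :
    patternDensity edgePattern g = edgeDensity g := by
  unfold patternDensity
  simp_rw [prod_edgePattern fun p => g _ _]
  rw [edgeDensity_eq_integral_prod hg, ← (measurePreserving_vecTwo unitMeasure).map_eq,
    integral_map (measurePreserving_vecTwo unitMeasure).measurable.aemeasurable]
  · rfl
  · exact (hg.1.comp (by fun_prop : Measurable fun y : Fin 2 → ℝ =>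
      (y 0, y 1))).aestronglyMeasurable

theorem patternDensity_trianglePattern {g : ℝ → ℝ → ℝ} (hg : IsGraphon g) :
    patternDensity trianglePattern g = triangleDensity g := by
  unfold patternDensity
  have := hg.1
  simp_rw [fun y : Fin 3 → ℝ => prod_trianglePattern fun p => g (y p.1) (y p.2)]
  rw [triangleDensity_eq_trip hg, ← (measurePreserving_vecThree unitMeasure).map_eq,
    integral_map (measurePreserving_vecThree unitMeasure).measurable.aemeasurable]
  · rfl
  · have h : ∀ i j, Measurable fun y : Fin 3 → ℝ => g (y i) (y j) := fun i j =>
      hg.1.comp (by fun_prop : Measurable fun y : Fin 3 → ℝ => (y i, y j))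
    exact (((h 0 1).mul (h 1 2)).mul (h 2 0)).aestronglyMeasurable

theorem integral_I0_sample {g : ℝ → ℝ → ℝ} (hg : IsGraphon g) {n : ℕ} {i j : Fin n}
    (hij : i ≠ j) : ∫ x : Fin n → ℝ, I0 (g (x i) (x j)) ∂(Measure.pi fun _ => unitMeasure) =
      rate g := by
  have hc : Function.Injective ![i, j] := by
    intro a b hab
    fin_cases a <;> fin_cases b <;> simp_all [hij.symm]
  have hm : Measurable fun y : Fin 2 → ℝ => I0 (g (y 0) (y 1)) :=
    continuous_I0.measurable.comp
      (hg.1.comp (by fun_prop : Measurable fun y : Fin 2 → ℝ => (y 0, y 1)))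
  have h1 := measurePreserving_comp_injective unitMeasure hc
  have h2 := measurePreserving_vecTwo unitMeasure
  rw [rate_eq_integral_prod hg]
  trans ∫ y : Fin 2 → ℝ, I0 (g (y 0) (y 1)) ∂(Measure.pi fun _ => unitMeasure)
  · rw [← h1.map_eq, integral_map h1.measurable.aemeasurable hm.aestronglyMeasurable]
    rfl
  · rw [← h2.map_eq, integral_map h2.measurable.aemeasurable hm.aestronglyMeasurable]
    rfl

theorem two_mul_card_edgeSlot (n : ℕ) : 2 * (Fintype.card (EdgeSlot n) : ℝ) = (n : ℝ) ^ 2 - n := by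
  have := two_mul_sum_edgeSlot (n := n) fun _ => 1
  simp only [Finset.sum_const, Finset.card_univ, nsmul_eq_mul, mul_one] at this
  rw [this]
  have h : ∀ i : Fin n, ∑ j : Fin n, (if i = j then (0 : ℝ) else 1) = n - 1 := by
    intro i
    have : ∀ j : Fin n, (if i = j then (0 : ℝ) else 1) = 1 - if i = j then 1 else 0 := by
      intro j
      split_ifs <;> simp
    simp [this]
  simp [h]
  ring

theorem card_simpleGraph (n : ℕ) :
    Fintype.card (SimpleGraph (Fin n)) = 2 ^ Fintype.card (EdgeSlot n) := by
  rw [Fintype.card_congr (graphEquivBool n)]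
  simp

theorem integral_entropy_sample {g : ℝ → ℝ → ℝ} (hg : IsGraphon g) (n : ℕ) :
    ∫ x : Fin n → ℝ, ∑ s : EdgeSlot n, 2 * I0 (sampleProb hg x s.1)
      ∂(Measure.pi fun _ => unitMeasure) = rate g * ((n : ℝ) ^ 2 - n) := by
  have hm : ∀ s : EdgeSlot n, Integrable (fun x : Fin n → ℝ => 2 * I0 (sampleProb hg x s.1))
      (Measure.pi fun _ => unitMeasure) := fun s => by
    refine (integrable_of_abs_le (continuous_I0.measurable.comp (measurable_sampleProb hg s.1)) 1
      fun x => abs_I0_le (sampleProb_mem hg x s.1)).const_mul 2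
  rw [integral_finsetSum _ fun s _ => hm s]
  have h : ∀ s : EdgeSlot n, ∫ x : Fin n → ℝ, 2 * I0 (sampleProb hg x s.1)
      ∂(Measure.pi fun _ => unitMeasure) = 2 * rate g := by
    rintro ⟨s, hs⟩
    induction s using Sym2.inductionOn with
    | hf i j =>
      rw [integral_const_mul]
      congr 1
      exact integral_I0_sample hg (by simpa using hs)
  simp only [h, Finset.sum_const, Finset.card_univ, nsmul_eq_mul, ← two_mul_card_edgeSlot]
  ring

theorem le_log_card_add {g : ℝ → ℝ → ℝ} (hg : IsGraphon g) {n : ℕ}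
    [DecidableEq (SimpleGraph (Fin n))]
    (A : Finset (SimpleGraph (Fin n))) :
    -rate g * ((n : ℝ) ^ 2 - n) ≤ log 2 + log A.card +
      (∑ G ∈ Aᶜ, sampleWeight hg G) * (((n : ℝ) ^ 2 - n) / 2 * log 2) := by
  have h := fun x : Fin n → ℝ =>
    neg_sum_mul_log_le (graphWeight_nonneg (sampleProb_mem hg x)) (sum_graphWeight _) A
  simp only [sum_graphWeight_mul_log] at h
  have hF : log (Fintype.card (SimpleGraph (Fin n)) : ℝ) = ((n : ℝ) ^ 2 - n) / 2 * log 2 := by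
    rw [card_simpleGraph, ← two_mul_card_edgeSlot]
    push_cast
    rw [log_pow]
    ring
  rw [hF] at h
  have h1 : Integrable (fun x : Fin n → ℝ => - ∑ s : EdgeSlot n, 2 * I0 (sampleProb hg x s.1))
      (Measure.pi fun _ => unitMeasure) :=
    (integrable_finsetSum _ fun s _ => (integrable_of_abs_le
      (continuous_I0.measurable.comp (measurable_sampleProb hg s.1)) 1
      fun x => abs_I0_le (sampleProb_mem hg x s.1)).const_mul 2).neg
  have h2 : Integrable (fun x => ∑ G ∈ Aᶜ, graphWeight (sampleProb hg x) G)
      (Measure.pi fun _ => unitMeasure) :=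
    integrable_finsetSum _ fun G _ => integrable_graphWeight hg G
  have h3 := integral_mono h1 ((integrable_const (log 2 + log (A.card : ℝ))).add
    (h2.mul_const (((n : ℝ) ^ 2 - n) / 2 * log 2))) h
  rw [integral_neg, integral_entropy_sample] at h3
  simp only [Pi.add_apply] at h3
  rw [integral_add (integrable_const _) (h2.mul_const _), integral_mul_const,
    integral_finsetSum _ fun G _ => integrable_graphWeight hg G, integral_const] at h3
  simpa [sampleWeight] using h3

end Concentration

section LowerBound

theorem abs_div_choose_sub_le {T k n : ℕ} (hn : 0 < n) (hT : T ≤ n.choose k) :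
    |(T : ℝ) / n.choose k - k.factorial * T / (n : ℝ) ^ k| ≤ (k : ℝ) ^ 2 / n := by
  have hn' : (0 : ℝ) < n := by exact_mod_cast hn
  have hpos : (0 : ℝ) < (n : ℝ) ^ k := by positivity
  rcases Nat.eq_zero_or_pos (n.choose k) with h | h
  · have hT0 : T = 0 := by omega
    simp only [hT0, Nat.cast_zero, zero_div, mul_zero, sub_zero, abs_zero]
    positivity
  have hc : (0 : ℝ) < n.choose k := by exact_mod_cast h
  have hd : (n.descFactorial k : ℝ) = k.factorial * n.choose k := by
    exact_mod_cast Nat.descFactorial_eq_factorial_mul_choose n k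
  have hle : (n.descFactorial k : ℝ) / (n : ℝ) ^ k ≤ 1 := by
    rw [div_le_one hpos]
    exact_mod_cast Nat.descFactorial_le_pow n k
  have h1 : (T : ℝ) / n.choose k - k.factorial * T / (n : ℝ) ^ k =
      (T : ℝ) / n.choose k * (1 - (n.descFactorial k : ℝ) / (n : ℝ) ^ k) := by
    rw [hd]
    field_simp
  have h2 : (T : ℝ) / n.choose k ≤ 1 := by
    rw [div_le_one hc]
    exact_mod_cast hT
  rw [h1, abs_of_nonneg (mul_nonneg (by positivity) (by linarith))]
  exact (mul_le_of_le_one_left (by linarith) h2).trans (one_sub_descFactorial_div_pow_le k hn)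

theorem homDensity_edgePattern {n : ℕ} (w : Fin n × Fin n → ℝ) :
    homDensity edgePattern w = (∑ i, ∑ j, w (i, j)) / (n : ℝ) ^ 2 := by
  unfold homDensity
  simp_rw [prod_edgePattern fun p => w _]
  rw [Fintype.card_fin, ← Fintype.sum_prod_type']
  congr 1
  convert! Fintype.sum_equiv (finTwoArrowEquiv (Fin n)) _ (fun p : Fin n × Fin n => w (p.1, p.2))
    fun _ => rfl

theorem homDensity_edgePattern_adjKernel {n : ℕ} (G : SimpleGraph (Fin n)) :
    homDensity edgePattern (adjKernel G) =
      Nat.factorial 2 * (Nat.card G.edgeSet : ℝ) / (n : ℝ) ^ 2 := by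
  classical
  rw [homDensity_edgePattern]
  congr 1
  have h1 := two_mul_sum_edgeSlot (n := n) fun s => if s ∈ G.edgeSet then (1 : ℝ) else 0
  have h2 : ∀ i j : Fin n, (if i = j then (0 : ℝ) else if s(i, j) ∈ G.edgeSet then 1 else 0) =
      adjKernel G (i, j) := by
    intro i j
    by_cases hij : i = j
    · subst hij
      simp [adjKernel]
    · simp [adjKernel, hij]
  simp only [h2] at h1
  rw [← h1, Finset.sum_boole]
  have h3 : Nat.card G.edgeSet = Fintype.card {s : EdgeSlot n // s.1 ∈ G.edgeSet} := by
    rw [← Nat.card_eq_fintype_card]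
    refine Nat.card_congr ⟨fun s => ⟨⟨s.1, G.not_isDiag_of_mem_edgeSet s.2⟩, s.2⟩,
      fun s => ⟨s.1.1, s.2⟩, fun _ => rfl, fun _ => rfl⟩
  rw [h3, Fintype.card_subtype]
  norm_num

theorem card_labelled_clique {n : ℕ} (G : SimpleGraph (Fin n)) :
    Nat.card {c : Fin 3 → Fin n // G.Adj (c 0) (c 1) ∧ G.Adj (c 1) (c 2) ∧ G.Adj (c 2) (c 0)} =
      Nat.factorial 3 * Nat.card {s : Finset (Fin n) // G.IsNClique 3 s} := by
  classical
  rw [Nat.card_eq_fintype_card, Nat.card_eq_fintype_card, Fintype.card_subtype,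
    Fintype.card_subtype]
  have hinj : ∀ c : Fin 3 → Fin n,
      G.Adj (c 0) (c 1) ∧ G.Adj (c 1) (c 2) ∧ G.Adj (c 2) (c 0) → Function.Injective c := by
    intro c ⟨h1, h2, h3⟩ a b hab
    have := h1.ne
    have := h2.ne
    have := h3.ne
    fin_cases a <;> fin_cases b <;> simp_all
  have hadj : ∀ c : Fin 3 → Fin n,
      (G.Adj (c 0) (c 1) ∧ G.Adj (c 1) (c 2) ∧ G.Adj (c 2) (c 0)) ↔
        Function.Injective c ∧ G.IsNClique 3 (Finset.univ.image c) := by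
    intro c
    constructor
    · intro h
      refine ⟨hinj c h, ?_⟩
      rw [SimpleGraph.isNClique_iff, Finset.card_image_of_injective _ (hinj c h)]
      refine ⟨?_, by simp⟩
      obtain ⟨h1, h2, h3⟩ := h
      intro x hx y hy hxy
      simp only [Finset.coe_image, Finset.coe_univ, Set.image_univ, Set.mem_range] at hx hy
      obtain ⟨a, rfl⟩ := hx
      obtain ⟨b, rfl⟩ := hy
      have h4 := h1.symm
      have h5 := h2.symm
      have h6 := h3.symm
      fin_cases a <;> fin_cases b <;> first | exact absurd rfl hxy | assumption
    · rintro ⟨hi, hc⟩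
      have h : ∀ a b : Fin 3, a ≠ b → G.Adj (c a) (c b) := fun a b hab =>
        hc.1 (by simp) (by simp) (hi.ne hab)
      exact ⟨h _ _ (by decide), h _ _ (by decide), h _ _ (by decide)⟩
  rw [Finset.card_eq_sum_card_fiberwise (f := fun c : Fin 3 → Fin n => Finset.univ.image c)
    (t := Finset.univ.filter fun s => G.IsNClique 3 s), Finset.sum_const_nat (m := 6), mul_comm]
  · rfl
  · intro s hs
    have hs' : G.IsNClique 3 s := by simpa using hs
    have h6 : Fintype.card (Fin 3 ↪ s) = 6 := by
      rw [Fintype.card_embedding_eq, Fintype.card_coe, hs'.2]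
      rfl
    rw [← h6, ← Finset.card_univ]
    symm
    refine Finset.card_bij (fun φ _ => fun a => (φ a : Fin n)) ?_ ?_ ?_
    · intro φ _
      have hφ : Function.Injective fun a => (φ a : Fin n) :=
        Subtype.val_injective.comp φ.injective
      have him : (Finset.univ.image fun a => (φ a : Fin n)) = s := by
        refine Finset.eq_of_subset_of_card_le ?_ ?_
        · intro x hx
          obtain ⟨a, -, rfl⟩ := Finset.mem_image.1 hx
          exact (φ a).2
        · rw [Finset.card_image_of_injective _ hφ, hs'.2]
          simp
      simp only [Finset.mem_filter, Finset.mem_univ, true_and]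
      refine ⟨(hadj _).2 ⟨hφ, ?_⟩, him⟩
      rw [him]
      exact hs'
    · intro φ _ ψ _ h
      ext a
      exact congrArg Fin.val (congrFun h a)
    · intro c hc
      simp only [Finset.mem_filter, Finset.mem_univ, true_and] at hc
      have hm : ∀ a, c a ∈ s := fun a => by
        rw [← hc.2]
        exact Finset.mem_image_of_mem _ (Finset.mem_univ _)
      exact ⟨⟨fun a => ⟨c a, hm a⟩, fun a b h => hinj c hc.1 (congrArg Subtype.val h)⟩,
        Finset.mem_univ _, rfl⟩
  · intro c hc
    have hc' : G.Adj (c 0) (c 1) ∧ G.Adj (c 1) (c 2) ∧ G.Adj (c 2) (c 0) := by simpa using hc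
    simpa using ((hadj c).1 hc').2

theorem homDensity_trianglePattern_adjKernel {n : ℕ} (G : SimpleGraph (Fin n)) :
    homDensity trianglePattern (adjKernel G) =
      Nat.factorial 3 * (Nat.card {s : Finset (Fin n) // G.IsNClique 3 s} : ℝ) / (n : ℝ) ^ 3 := by
  classical
  unfold homDensity
  rw [Fintype.card_fin]
  congr 1
  have h := card_labelled_clique G
  rw [Nat.card_eq_fintype_card, Fintype.card_subtype] at h
  rw [← Nat.cast_mul, ← h, ← Finset.sum_boole]
  convert Finset.sum_congr rfl fun c _ => ?_
  rw [prod_trianglePattern fun p => adjKernel G _]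
  simp only [adjKernel, ite_zero_mul_ite_zero, mul_one, and_assoc]

theorem abs_graphEdgeDensity_sub_le {n : ℕ} (hn : 0 < n) (G : SimpleGraph (Fin n)) :
    |graphEdgeDensity G - homDensity edgePattern (adjKernel G)| ≤ 4 / n := by
  classical
  rw [homDensity_edgePattern_adjKernel, graphEdgeDensity]
  refine (abs_div_choose_sub_le hn ?_).trans (by norm_num)
  rw [Nat.card_eq_fintype_card, ← SimpleGraph.edgeFinset_card]
  simpa using G.card_edgeFinset_le_card_choose_two

theorem abs_graphTriangleDensity_sub_le {n : ℕ} (hn : 0 < n) (G : SimpleGraph (Fin n)) :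
    |graphTriangleDensity G - homDensity trianglePattern (adjKernel G)| ≤ 9 / n := by
  classical
  rw [homDensity_trianglePattern_adjKernel, graphTriangleDensity]
  refine (abs_div_choose_sub_le hn ?_).trans (by norm_num)
  rw [Nat.card_eq_fintype_card, Fintype.card_subtype]
  calc _ ≤ (Finset.powersetCard 3 (Finset.univ : Finset (Fin n))).card := by
        refine Finset.card_le_card fun s hs => ?_
        have hs' : G.IsNClique 3 s := by simpa using hs
        simpa [Finset.mem_powersetCard] using hs'.2
    _ = _ := by simp

theorem neg_rate_mul_le {g : ℝ → ℝ → ℝ} (hg : IsGraphon g) {δ : ℝ} (hδ : 0 < δ) {n : ℕ}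
    (hn : 0 < n) (hnδ : 9 / (n : ℝ) ≤ δ / 2) :
    -rate g * ((n : ℝ) ^ 2 - n) ≤ log 2 + log (Z n δ (edgeDensity g) (triangleDensity g)) +
      312 / (δ ^ 2 * n) * (((n : ℝ) ^ 2 - n) / 2 * log 2) := by
  classical
  have hn' : (0 : ℝ) < n := by exact_mod_cast hn
  set e := edgeDensity g with he
  set t := triangleDensity g with ht
  let S₁ : Finset (SimpleGraph (Fin n)) :=
    Finset.univ.filter fun G => δ / 2 ≤ |homDensity edgePattern (adjKernel G) - e|
  let S₂ : Finset (SimpleGraph (Fin n)) :=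
    Finset.univ.filter fun G => δ / 2 ≤ |homDensity trianglePattern (adjKernel G) - t|
  have h1 := sum_sampleWeight_mul_sq_le hg isOriented_edgePattern hn
  have h2 := sum_sampleWeight_mul_sq_le hg isOriented_trianglePattern hn
  rw [patternDensity_edgePattern hg] at h1
  rw [patternDensity_trianglePattern hg] at h2
  have h3 := sum_mul_indicator_le (sampleWeight_nonneg hg) (half_pos hδ) h1 S₁
    fun G hG => (Finset.mem_filter.1 hG).2
  have h4 := sum_mul_indicator_le (sampleWeight_nonneg hg) (half_pos hδ) h2 S₂
    fun G hG => (Finset.mem_filter.1 hG).2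
  have h5 : ∑ G ∈ S₁ ∪ S₂, sampleWeight hg G ≤ 312 / (δ ^ 2 * n) := by
    have := Finset.sum_union_inter (s₁ := S₁) (s₂ := S₂) (f := fun G => sampleWeight hg G)
    have h0 : 0 ≤ ∑ G ∈ S₁ ∩ S₂, sampleWeight hg G :=
      Finset.sum_nonneg fun G _ => sampleWeight_nonneg hg G
    have e1 : 6 * ((Fintype.card (Fin 2) : ℕ) : ℝ) ^ 2 / n / (δ / 2) ^ 2 +
        6 * ((Fintype.card (Fin 3) : ℕ) : ℝ) ^ 2 / n / (δ / 2) ^ 2 = 312 / (δ ^ 2 * n) := by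
      simp only [Fintype.card_fin]
      field_simp
      norm_num
    linarith
  have h6 := le_log_card_add hg (S₁ ∪ S₂)ᶜ
  rw [compl_compl] at h6
  have hsq : (0 : ℝ) ≤ ((n : ℝ) ^ 2 - n) / 2 * log 2 := by
    have : (1 : ℝ) ≤ n := by exact_mod_cast hn
    have := log_pos one_lt_two
    have : (0 : ℝ) ≤ (n : ℝ) ^ 2 - n := by nlinarith
    positivity
  have h7 := mul_le_mul_of_nonneg_right h5 hsq
  have h8 : log (((S₁ ∪ S₂)ᶜ.card : ℕ) : ℝ) ≤ log (Z n δ e t) := by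
    have hc : (S₁ ∪ S₂)ᶜ.card ≤ Z n δ e t := by
      rw [Z, Nat.card_eq_fintype_card, Fintype.card_subtype]
      refine Finset.card_le_card fun G hG => ?_
      simp only [S₁, S₂, Finset.mem_compl, Finset.mem_union, Finset.mem_filter, Finset.mem_univ,
        true_and, not_or, not_le] at hG
      have a1 := abs_le.1 (abs_graphEdgeDensity_sub_le hn G)
      have a2 := abs_le.1 (abs_graphTriangleDensity_sub_le hn G)
      have a3 := abs_lt.1 hG.1
      have a4 := abs_lt.1 hG.2
      have a5 : 4 / (n : ℝ) ≤ 9 / n := by gcongr; norm_num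
      simp only [Finset.mem_filter, Finset.mem_univ, true_and, Set.mem_Ioo]
      refine ⟨⟨?_, ?_⟩, ?_, ?_⟩ <;> linarith
    rcases Nat.eq_zero_or_pos (S₁ ∪ S₂)ᶜ.card with h | h
    · rw [h]
      simpa using log_natCast_nonneg _
    · exact log_le_log (by exact_mod_cast h) (by exact_mod_cast hc)
  linarith

theorem eventually_le_log_Z {g : ℝ → ℝ → ℝ} (hg : IsGraphon g) {δ : ℝ} (hδ : 0 < δ) {c : ℝ}
    (hc : c < -rate g) :
    ∀ᶠ n : ℕ in atTop, c ≤ log (Z n δ (edgeDensity g) (triangleDensity g)) / (n : ℝ) ^ 2 := by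
  have h0 : Tendsto (fun n : ℕ => (n : ℝ)⁻¹) atTop (nhds 0) := tendsto_inv_atTop_nhds_zero_nat
  have h1 : Tendsto (fun n : ℕ => -rate g * (1 - (n : ℝ)⁻¹) - log 2 * (n : ℝ)⁻¹ * (n : ℝ)⁻¹ -
      312 / δ ^ 2 * (n : ℝ)⁻¹ * ((1 - (n : ℝ)⁻¹) / 2 * log 2)) atTop
      (nhds (-rate g * (1 - 0) - log 2 * 0 * 0 - 312 / δ ^ 2 * 0 * ((1 - 0) / 2 * log 2))) :=
    (((h0.const_sub 1).const_mul _).sub ((h0.const_mul _).mul h0)).sub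
      ((h0.const_mul _).mul (((h0.const_sub 1).div_const 2).mul_const _))
  have h2 : Tendsto (fun n : ℕ => 9 / (n : ℝ)) atTop (nhds 0) :=
    tendsto_const_div_atTop_nhds_zero_nat 9
  filter_upwards [h1.eventually_const_lt (u := c) (by simpa using hc),
    h2.eventually_lt_const (half_pos hδ), eventually_gt_atTop 0] with n hn1 hn2 hn
  have hn' : (0 : ℝ) < n := by exact_mod_cast hn
  have h3 := neg_rate_mul_le hg hδ hn hn2.le
  refine hn1.le.trans ?_
  rw [le_div_iff₀ (by positivity)]
  have h4 : (-rate g * (1 - (n : ℝ)⁻¹) - log 2 * (n : ℝ)⁻¹ * (n : ℝ)⁻¹ -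
      312 / δ ^ 2 * (n : ℝ)⁻¹ * ((1 - (n : ℝ)⁻¹) / 2 * log 2)) * (n : ℝ) ^ 2 =
      -rate g * ((n : ℝ) ^ 2 - n) - log 2 -
        312 / (δ ^ 2 * n) * (((n : ℝ) ^ 2 - n) / 2 * log 2) := by
    field_simp
  linarith

end LowerBound

section Uniform

/-- The uniform probability measure on `Fin n`. -/
noncomputable def finMeasure (n : ℕ) : Measure (Fin n) := (n : ENNReal)⁻¹ • Measure.count

instance isProbabilityMeasure_finMeasure (n : ℕ) [NeZero n] :
    IsProbabilityMeasure (finMeasure n) := by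
  constructor
  rw [finMeasure, Measure.smul_apply, Measure.count_univ, smul_eq_mul]
  simp only [ENat.card_eq_coe_fintype_card, Fintype.card_fin]
  exact ENNReal.inv_mul_cancel (by simpa using NeZero.ne n) (by simp)

theorem integral_finMeasure (n : ℕ) (f : Fin n → ℝ) :
    ∫ x, f x ∂(finMeasure n) = (∑ x, f x) / n := by
  rw [finMeasure, integral_smul_measure, integral_count]
  simp [div_eq_inv_mul]

theorem integral_prod_finMeasure (n : ℕ) [NeZero n] (f : Fin n × Fin n → ℝ) :
    ∫ p, f p ∂((finMeasure n).prod (finMeasure n)) = (∑ x, ∑ y, f (x, y)) / (n : ℝ) ^ 2 := by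
  rw [integral_prod _ Integrable.of_finite]
  simp only [integral_finMeasure, ← Finset.sum_div]
  rw [div_div, sq]

theorem homDensity_edgePattern_eq_integral {n : ℕ} [NeZero n] (w : Fin n × Fin n → ℝ) :
    homDensity edgePattern w = ∫ p, w p ∂((finMeasure n).prod (finMeasure n)) := by
  rw [homDensity_edgePattern, integral_prod_finMeasure]

theorem homDensity_trianglePattern_eq_trip {n : ℕ} [NeZero n] (w : Fin n × Fin n → ℝ) :
    homDensity trianglePattern w = trip (finMeasure n) w w w := by
  have h1 : trip (finMeasure n) w w w =
      (∑ x, ∑ p : Fin n × Fin n, w (x, p.1) * w (p.1, p.2) * w (p.2, x)) / (n : ℝ) ^ 3 := by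
    rw [trip, integral_prod _ Integrable.of_finite]
    simp only [integral_prod_finMeasure, integral_finMeasure, ← Finset.sum_div]
    rw [div_div, ← pow_succ]
    simp only [Fintype.sum_prod_type]
  rw [h1]
  unfold homDensity
  rw [Fintype.card_fin]
  congr 1
  rw [← Fintype.sum_prod_type']
  convert! Fintype.sum_equiv (Equiv.mk (fun c : Fin 3 → Fin n => (c 0, c 1, c 2))
    (fun p => ![p.1, p.2.1, p.2.2]) (fun c => by ext i; fin_cases i <;> rfl) fun p => rfl) _
    (fun p : Fin n × Fin n × Fin n => w (p.1, p.2.1) * w (p.2.1, p.2.2) * w (p.2.2, p.1))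
    fun c => prod_trianglePattern fun p => w (c p.1, c p.2)

theorem cutLE_finMeasure_iff {n : ℕ} [NeZero n] {R : Fin n × Fin n → ℝ} {ε : ℝ} :
    CutLE (finMeasure n) R ε ↔ ∀ a b : Fin n → ℝ, (∀ x, |a x| ≤ 1) → (∀ x, |b x| ≤ 1) →
      |∑ x, ∑ y, R (x, y) * (a x * b y)| ≤ ε * (n : ℝ) ^ 2 := by
  have hn : (0 : ℝ) < n := by exact_mod_cast NeZero.pos n
  have h : ∀ s : ℝ, |s / (n : ℝ) ^ 2| ≤ ε ↔ |s| ≤ ε * (n : ℝ) ^ 2 := fun s => by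
    rw [abs_div, abs_of_pos (by positivity : (0 : ℝ) < (n : ℝ) ^ 2), div_le_iff₀ (by positivity)]
  simp only [CutLE, UnitFun, integral_prod_finMeasure, h, Measurable.of_discrete, true_and]

end Uniform

section Blocks

variable {n : ℕ} {K : Type*} [DecidableEq K]

/-- Size of a class of the partition of `Fin n` into fibres of `P`. -/
def classSize (P : Fin n → K) (k : K) : ℕ := (Finset.univ.filter fun x => P x = k).card

theorem classSize_pos (P : Fin n → K) (x : Fin n) : 0 < classSize P (P x) :=
  Finset.card_pos.2 ⟨x, by simp⟩

/-- Average over the classes of the partition into fibres of `P`. -/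
noncomputable def classAverage (P : Fin n → K) (a : Fin n → ℝ) (x : Fin n) : ℝ :=
  (∑ y, if P y = P x then a y else 0) / classSize P (P x)

theorem abs_classAverage_le (P : Fin n → K) {a : Fin n → ℝ} (ha : ∀ x, |a x| ≤ 1) (x : Fin n) :
    |classAverage P a x| ≤ 1 := by
  have h : (0 : ℝ) < classSize P (P x) := by exact_mod_cast classSize_pos P x
  rw [classAverage, abs_div, abs_of_pos h, div_le_one h, classSize, ← Finset.sum_boole]
  refine (Finset.abs_sum_le_sum_abs _ _).trans (Finset.sum_le_sum fun y _ => ?_)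
  split_ifs
  · exact ha y
  · simp

theorem sum_classAverage_mul (P : Fin n → K) (a : Fin n → ℝ) {h : Fin n → ℝ}
    (hh : ∀ x y, P x = P y → h x = h y) :
    ∑ x, classAverage P a x * h x = ∑ x, a x * h x := by
  have h1 : ∀ x, classAverage P a x * h x =
      ∑ y, if P y = P x then a y * h y / classSize P (P y) else 0 := by
    intro x
    rw [classAverage, div_mul_eq_mul_div, Finset.sum_mul, Finset.sum_div]
    refine Finset.sum_congr rfl fun y _ => ?_
    split_ifs with hxy
    · rw [hh y x hxy, hxy]
    · simp
  simp_rw [h1]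
  rw [Finset.sum_comm]
  refine Finset.sum_congr rfl fun y _ => ?_
  have hy : (0 : ℝ) < classSize P (P y) := by exact_mod_cast classSize_pos P y
  have h2 : ((Finset.univ.filter fun x => P y = P x).card : ℝ) = classSize P (P y) := by
    simp only [classSize, eq_comm]
  rw [← Finset.sum_filter, Finset.sum_const, nsmul_eq_mul, h2]
  field_simp

theorem classAverage_congr (P : Fin n → K) (a : Fin n → ℝ) (x y : Fin n) (h : P x = P y) :
    classAverage P a x = classAverage P a y := by
  simp only [classAverage, h]

theorem sum_classAverage_mul_comm (P : Fin n → K) (a b : Fin n → ℝ) :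
    ∑ x, classAverage P a x * b x = ∑ x, a x * classAverage P b x := by
  rw [← sum_classAverage_mul P a (classAverage_congr P b)]
  have := sum_classAverage_mul P b (classAverage_congr P a)
  simp only [mul_comm] at this ⊢
  rw [← this]

/-- Average of a kernel over the blocks of a partition. -/
noncomputable def blockAverage (P : Fin n → K) (A : Fin n × Fin n → ℝ) (p : Fin n × Fin n) : ℝ :=
  classAverage P (fun x => classAverage P (fun y => A (x, y)) p.2) p.1

theorem sum_blockAverage_mul (P : Fin n → K) (A : Fin n × Fin n → ℝ) (a b : Fin n → ℝ) :
    ∑ x, ∑ y, blockAverage P A (x, y) * (a x * b y) =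
      ∑ x, ∑ y, A (x, y) * (classAverage P a x * classAverage P b y) := by
  rw [Finset.sum_comm]
  have h1 : ∀ y, ∑ x, blockAverage P A (x, y) * (a x * b y) =
      ∑ x, classAverage P (fun y => A (x, y)) y * classAverage P a x * b y := by
    intro y
    simp only [← mul_assoc, ← Finset.sum_mul]
    congr 1
    exact sum_classAverage_mul_comm P (fun x => classAverage P (fun y => A (x, y)) y) a
  simp_rw [h1]
  rw [Finset.sum_comm]
  refine Finset.sum_congr rfl fun x _ => ?_
  have h2 := sum_classAverage_mul_comm P (fun y => A (x, y)) b
  calc _ = classAverage P a x * ∑ y, classAverage P (fun y => A (x, y)) y * b y := by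
        rw [Finset.mul_sum]
        exact Finset.sum_congr rfl fun y _ => by ring
    _ = _ := by
        rw [h2, Finset.mul_sum]
        exact Finset.sum_congr rfl fun y _ => by ring

theorem sum_classAverage_mul_kernel (P : Fin n → K) {h : Fin n → Fin n → ℝ}
    (hh : ∀ x x' y y', P x = P x' → P y = P y' → h x y = h x' y') (a b : Fin n → ℝ) :
    ∑ x, ∑ y, h x y * (classAverage P a x * classAverage P b y) =
      ∑ x, ∑ y, h x y * (a x * b y) := by
  have h1 : ∀ x, ∑ y, h x y * (classAverage P a x * classAverage P b y) =
      ∑ y, h x y * (classAverage P a x * b y) := by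
    intro x
    have := sum_classAverage_mul P b (h := h x) fun y y' hy => hh x x y y' rfl hy
    calc _ = classAverage P a x * ∑ y, classAverage P b y * h x y := by
          rw [Finset.mul_sum]
          exact Finset.sum_congr rfl fun y _ => by ring
      _ = _ := by
          rw [this, Finset.mul_sum]
          exact Finset.sum_congr rfl fun y _ => by ring
  simp_rw [h1]
  rw [Finset.sum_comm, Finset.sum_comm (f := fun x y => h x y * (a x * b y))]
  refine Finset.sum_congr rfl fun y _ => ?_
  have := sum_classAverage_mul P a (h := fun x => h x y) fun x x' hx => hh x x' y y hx rfl
  calc _ = b y * ∑ x, classAverage P a x * h x y := by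
        rw [Finset.mul_sum]
        exact Finset.sum_congr rfl fun y _ => by ring
    _ = _ := by
        rw [this, Finset.mul_sum]
        exact Finset.sum_congr rfl fun y _ => by ring

theorem CutLE.sub_blockAverage [NeZero n] (P : Fin n → K) {A h : Fin n × Fin n → ℝ}
    (hh : ∀ x x' y y', P x = P x' → P y = P y' → h (x, y) = h (x', y')) {ε : ℝ}
    (hA : CutLE (finMeasure n) (fun p => A p - h p) ε) :
    CutLE (finMeasure n) (fun p => A p - blockAverage P A p) (2 * ε) := by
  rw [cutLE_finMeasure_iff] at hA ⊢
  intro a b ha hb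
  have h1 := hA a b ha hb
  have h2 := hA _ _ (abs_classAverage_le P ha) (abs_classAverage_le P hb)
  have h3 := sum_blockAverage_mul P A a b
  have h4 := sum_classAverage_mul_kernel P (h := fun x y => h (x, y)) hh a b
  simp only [sub_mul, Finset.sum_sub_distrib] at h1 h2 ⊢
  rw [abs_le] at h1 h2 ⊢
  constructor <;> linarith [h1.1, h1.2, h2.1, h2.2]

theorem classAverage_mem (P : Fin n → K) {a : Fin n → ℝ} (ha : ∀ x, a x ∈ Icc (0 : ℝ) 1)
    (x : Fin n) : classAverage P a x ∈ Icc (0 : ℝ) 1 := by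
  refine ⟨div_nonneg (Finset.sum_nonneg fun y _ => ?_) (Nat.cast_nonneg _), (le_abs_self _).trans
    (abs_classAverage_le P (fun x => abs_le_one_of_mem_Icc (ha x)) x)⟩
  split_ifs
  · exact (ha y).1
  · exact le_rfl

theorem classAverage_pos (P : Fin n → K) {a : Fin n → ℝ} (ha : ∀ x, 0 ≤ a x)
    {x : Fin n} (hx : 0 < a x) : 0 < classAverage P a x := by
  have h : (0 : ℝ) < classSize P (P x) := by exact_mod_cast classSize_pos P x
  refine div_pos (Finset.sum_pos' (fun y _ => ?_) ⟨x, Finset.mem_univ _, by simpa using hx⟩) h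
  split_ifs
  · exact ha y
  · exact le_rfl

theorem classAverage_const_sub (P : Fin n → K) (a : Fin n → ℝ) (x : Fin n) :
    classAverage P (fun y => 1 - a y) x = 1 - classAverage P a x := by
  have h : (0 : ℝ) < classSize P (P x) := by exact_mod_cast classSize_pos P x
  have h1 : ∀ y, (if P y = P x then 1 - a y else 0) =
      (if P y = P x then (1 : ℝ) else 0) - if P y = P x then a y else 0 := by
    intro y
    split_ifs <;> simp
  simp only [classAverage, h1, Finset.sum_sub_distrib, sub_div]
  congr 1
  rw [Finset.sum_boole]
  exact div_self h.ne'

theorem blockAverage_mem (P : Fin n → K) {A : Fin n × Fin n → ℝ}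
    (hA : ∀ p, A p ∈ Icc (0 : ℝ) 1) (p : Fin n × Fin n) : blockAverage P A p ∈ Icc (0 : ℝ) 1 :=
  classAverage_mem P (fun x => classAverage_mem P (fun y => hA (x, y)) p.2) p.1

theorem blockAverage_pos (P : Fin n → K) {A : Fin n × Fin n → ℝ} (hA : ∀ p, 0 ≤ A p)
    {p : Fin n × Fin n} (hp : 0 < A p) : 0 < blockAverage P A p :=
  classAverage_pos P (fun _ => div_nonneg (Finset.sum_nonneg fun y _ => by
    split_ifs
    · exact hA _
    · exact le_rfl) (Nat.cast_nonneg _))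
    (classAverage_pos P (fun y => hA (p.1, y)) hp)

theorem blockAverage_one_sub (P : Fin n → K) (A : Fin n × Fin n → ℝ) (p : Fin n × Fin n) :
    blockAverage P (fun p => 1 - A p) p = 1 - blockAverage P A p := by
  simp only [blockAverage, classAverage_const_sub]

theorem blockAverage_congr (P : Fin n → K) (A : Fin n × Fin n → ℝ) (x x' y y' : Fin n)
    (hx : P x = P x') (hy : P y = P y') :
    blockAverage P A (x, y) = blockAverage P A (x', y') := by
  simp only [blockAverage, classAverage, hx, hy]

theorem blockAverage_eq (P : Fin n → K) (A : Fin n × Fin n → ℝ) (p : Fin n × Fin n) :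
    blockAverage P A p =
      (∑ x, ∑ y, if P x = P p.1 ∧ P y = P p.2 then A (x, y) else 0) /
        (classSize P (P p.2) * classSize P (P p.1)) := by
  simp only [blockAverage, classAverage]
  rw [← div_div]
  congr 1
  rw [Finset.sum_div]
  refine Finset.sum_congr rfl fun x _ => ?_
  by_cases h : P x = P p.1 <;> simp [h]

theorem blockAverage_swap (P : Fin n → K) {A : Fin n × Fin n → ℝ} (hA : ∀ p, A p.swap = A p)
    (p : Fin n × Fin n) : blockAverage P A p.swap = blockAverage P A p := by
  rw [blockAverage_eq, blockAverage_eq, Finset.sum_comm, mul_comm]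
  congr 1
  refine Finset.sum_congr rfl fun x _ => Finset.sum_congr rfl fun y _ => ?_
  rw [← hA (x, y)]
  simp only [Prod.swap, and_comm]

theorem sum_blockAverage_mul_kernel (P : Fin n → K) (A : Fin n × Fin n → ℝ)
    {h : Fin n → Fin n → ℝ} (hh : ∀ x x' y y', P x = P x' → P y = P y' → h x y = h x' y') :
    ∑ x, ∑ y, blockAverage P A (x, y) * h x y = ∑ x, ∑ y, A (x, y) * h x y := by
  have h1 : ∀ y, ∑ x, blockAverage P A (x, y) * h x y =
      ∑ x, classAverage P (fun y => A (x, y)) y * h x y := fun y =>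
    sum_classAverage_mul P (fun x => classAverage P (fun y => A (x, y)) y) (h := fun x => h x y)
      fun x x' hx => hh x x' y y hx rfl
  rw [Finset.sum_comm]
  simp_rw [h1]
  rw [Finset.sum_comm]
  exact Finset.sum_congr rfl fun x _ =>
    sum_classAverage_mul P (fun y => A (x, y)) (h := h x) fun y y' hy => hh x x y y' rfl hy

end Blocks

section Counting

theorem exists_partition {ε : ℝ} (hε : 0 < ε) {N : ℕ} (hN : 1 < N * ε ^ 2) {n : ℕ} [NeZero n]
    (G : SimpleGraph (Fin n)) : ∃ P : Fin n → Fin N → SignType × SignType,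
      CutLE (finMeasure n) (fun p => adjKernel G p - blockAverage P (adjKernel G) p) (2 * ε) := by
  obtain ⟨u, v, hu, hv, h⟩ := exists_cut_approx (finMeasure n) (D := adjKernel G)
    Measurable.of_discrete (fun p => abs_le_one_of_mem_Icc (adjKernel_mem G p)) hε hN
  refine ⟨fun x i => (SignType.sign (u i x), SignType.sign (v i x)),
    CutLE.sub_blockAverage _ ?_ h⟩
  have hs : ∀ {a b : ℝ}, a ∈ ({-1, 0, 1} : Set ℝ) → b ∈ ({-1, 0, 1} : Set ℝ) →
      SignType.sign a = SignType.sign b → a = b := by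
    intro a b ha hb
    rcases ha with rfl | rfl | rfl <;> rcases hb with rfl | rfl | rfl <;> simp
  intro x x' y y' hx hy
  congr 1
  refine Finset.sum_congr rfl fun i hi => ?_
  have hx' := congrFun hx ⟨i, Finset.mem_range.1 hi⟩
  have hy' := congrFun hy ⟨i, Finset.mem_range.1 hi⟩
  simp only [Prod.mk.injEq] at hx' hy'
  rw [hs ((hu i).2 x) ((hu i).2 x') hx'.1, hs ((hv i).2 y) ((hv i).2 y') hy'.2]

variable {n : ℕ} {K : Type*} [DecidableEq K]

theorem exp_sum_I0_le_graphWeight (P : Fin n → K) (G : SimpleGraph (Fin n))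
    {p : Sym2 (Fin n) → ℝ} (hp : ∀ i j, p s(i, j) = blockAverage P (adjKernel G) (i, j)) :
    exp (∑ i, ∑ j, I0 (blockAverage P (adjKernel G) (i, j))) ≤ graphWeight p G := by
  classical
  set A := adjKernel G with hA
  set E := blockAverage P A with hE
  have hAmem := adjKernel_mem G
  have hEmem : ∀ q, E q ∈ Icc (0 : ℝ) 1 := blockAverage_mem P hAmem
  have hpos : ∀ s : EdgeSlot n, 0 < if s.1 ∈ G.edgeSet then p s.1 else 1 - p s.1 := by
    rintro ⟨s, hs⟩
    induction s using Sym2.inductionOn with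
    | hf i j =>
      simp only [hp]
      split_ifs with h
      · refine blockAverage_pos P (fun q => (hAmem q).1) ?_
        simp only [adjKernel]
        rw [if_pos (by simpa using h)]
        exact one_pos
      · rw [← blockAverage_one_sub]
        refine blockAverage_pos P (fun q => sub_nonneg.2 (hAmem q).2) ?_
        simp only [adjKernel]
        rw [if_neg (by simpa using h)]
        simp
  have hw : 0 < graphWeight p G := Finset.prod_pos fun s _ => by
    convert hpos s
  rw [← le_log_iff_exp_le hw]
  let F : Sym2 (Fin n) → ℝ := fun s => if s ∈ G.edgeSet then log (p s) else log (1 - p s)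
  have h1 : log (graphWeight p G) = ∑ s : EdgeSlot n, F s.1 := by
    unfold graphWeight
    rw [log_prod fun s _ => ?_]
    · refine Finset.sum_congr rfl fun s _ => ?_
      simp only [F]
      split_ifs <;> rfl
    · exact (by convert hpos s : (0 : ℝ) < _).ne'
  have h2 := two_mul_sum_edgeSlot F
  have h3 : ∀ i j : Fin n, A (i, j) * log (E (i, j)) + (1 - A (i, j)) * log (1 - E (i, j)) ≤
      if i = j then 0 else F s(i, j) := by
    intro i j
    split_ifs with hij
    · subst hij
      have : A (i, i) = 0 := by simp [hA, adjKernel]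
      rw [this, zero_mul, zero_add, sub_zero, one_mul]
      exact log_nonpos (sub_nonneg.2 (hEmem _).2) (by linarith [(hEmem (i, i)).1])
    · simp only [F, hp, SimpleGraph.mem_edgeSet, hA, adjKernel]
      split_ifs <;> simp [hA, hE]
  have h4 : ∑ i, ∑ j, (A (i, j) * log (E (i, j)) + (1 - A (i, j)) * log (1 - E (i, j))) =
      2 * ∑ i, ∑ j, I0 (E (i, j)) := by
    have a1 := sum_blockAverage_mul_kernel P A (h := fun x y => log (E (x, y)))
      fun x x' y y' hx hy => by rw [hE, blockAverage_congr P A x x' y y' hx hy]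
    have a2 := sum_blockAverage_mul_kernel P (fun q => 1 - A q)
      (h := fun x y => log (1 - E (x, y)))
      fun x x' y y' hx hy => by rw [hE, blockAverage_congr P A x x' y y' hx hy]
    simp only [blockAverage_one_sub] at a2
    simp only [Finset.sum_add_distrib]
    rw [← a1, ← a2, Finset.mul_sum, ← Finset.sum_add_distrib]
    refine Finset.sum_congr rfl fun i _ => ?_
    rw [Finset.mul_sum, ← Finset.sum_add_distrib]
    refine Finset.sum_congr rfl fun j _ => ?_
    simp only [I0, ← hE]
    ring
  have h5 := Finset.sum_le_sum fun i (_ : i ∈ Finset.univ) =>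
    Finset.sum_le_sum fun j (_ : j ∈ Finset.univ) => h3 i j
  rw [h4, ← h2, ← h1] at h5
  linarith

theorem card_mul_exp_sum_I0_le (P : Fin n → K) (G₀ : SimpleGraph (Fin n))
    (C : Finset (SimpleGraph (Fin n)))
    (hC : ∀ G ∈ C, blockAverage P (adjKernel G) = blockAverage P (adjKernel G₀)) :
    (C.card : ℝ) * exp (∑ i, ∑ j, I0 (blockAverage P (adjKernel G₀) (i, j))) ≤ 1 := by
  let p : Sym2 (Fin n) → ℝ := Sym2.lift ⟨fun i j => blockAverage P (adjKernel G₀) (i, j),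
    fun i j => blockAverage_swap P (adjKernel_swap G₀) (j, i)⟩
  have hp : ∀ s, p s ∈ Icc (0 : ℝ) 1 := fun s =>
    s.inductionOn fun i j => blockAverage_mem P (adjKernel_mem G₀) _
  rw [← nsmul_eq_mul, ← Finset.sum_const, ← sum_graphWeight p]
  refine (Finset.sum_le_sum fun G hG => ?_).trans
    (Finset.sum_le_univ_sum_of_nonneg fun G => graphWeight_nonneg hp G)
  rw [← hC G hG]
  exact exp_sum_I0_le_graphWeight P G fun i j => by rw [hC G hG]; rfl

/-- Number of ordered adjacent pairs between two classes. -/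
noncomputable def blockCount (P : Fin n → K) (G : SimpleGraph (Fin n)) (k l : K) : ℕ := by
  classical
  exact (Finset.univ.filter fun q : Fin n × Fin n =>
    (P q.1 = k ∧ P q.2 = l) ∧ G.Adj q.1 q.2).card

theorem blockCount_lt (P : Fin n → K) (G : SimpleGraph (Fin n)) (k l : K) :
    blockCount P G k l < n ^ 2 + 1 := by
  classical
  refine Nat.lt_succ_of_le ((Finset.card_le_univ _).trans ?_)
  simp [sq]

theorem blockAverage_adjKernel (P : Fin n → K) (G : SimpleGraph (Fin n)) (p : Fin n × Fin n) :
    blockAverage P (adjKernel G) p =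
      blockCount P G (P p.1) (P p.2) / (classSize P (P p.2) * classSize P (P p.1)) := by
  classical
  rw [blockAverage_eq]
  congr 1
  unfold blockCount
  rw [← Finset.sum_boole, ← Fintype.sum_prod_type']
  refine Finset.sum_congr rfl fun q _ => ?_
  simp only [adjKernel, ite_and]

theorem log_card_le [Fintype K] [NeZero n] {ε : ℝ} (C : Finset (SimpleGraph (Fin n)))
    (hC : C.Nonempty) (hP : ∀ G : SimpleGraph (Fin n), ∃ P : Fin n → K,
      CutLE (finMeasure n) (fun p => adjKernel G p - blockAverage P (adjKernel G) p) ε) :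
    ∃ G ∈ C, ∃ E : Fin n × Fin n → ℝ, (∀ p, E p ∈ Icc (0 : ℝ) 1) ∧ (∀ p, E p.swap = E p) ∧
      CutLE (finMeasure n) (fun p => adjKernel G p - E p) ε ∧
      log C.card ≤ n * log (Fintype.card K) +
        (Fintype.card K : ℝ) ^ 2 * log ((n : ℝ) ^ 2 + 1) - ∑ i, ∑ j, I0 (E (i, j)) := by
  classical
  choose P hP using hP
  let code : SimpleGraph (Fin n) → (Fin n → K) × (K → K → Fin (n ^ 2 + 1)) := fun G =>
    (P G, fun k l => ⟨blockCount (P G) G k l, blockCount_lt _ _ _ _⟩)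
  let T := Fintype.card ((Fin n → K) × (K → K → Fin (n ^ 2 + 1)))
  obtain ⟨G₁, hG₁⟩ := hC
  have hT : (0 : ℝ) < T := by
    have : Nonempty ((Fin n → K) × (K → K → Fin (n ^ 2 + 1))) := ⟨code G₁⟩
    exact_mod_cast Fintype.card_pos
  have hc : (0 : ℝ) < C.card := by exact_mod_cast Finset.card_pos.2 ⟨G₁, hG₁⟩
  obtain ⟨y, -, hy⟩ := Finset.exists_le_card_fiber_of_nsmul_le_card_of_maps_to (s := C)
    (t := Finset.univ) (f := code) (b := (C.card : ℝ) / T) (fun _ _ => Finset.mem_univ _)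
    ⟨code G₁, Finset.mem_univ _⟩ (by
      rw [Finset.card_univ, nsmul_eq_mul, mul_div_cancel₀ _ hT.ne'])
  have hy0 : (0 : ℝ) < (C.filter fun G => code G = y).card := lt_of_lt_of_le (by positivity) hy
  obtain ⟨G₀, hG₀⟩ := Finset.card_pos.1 (by exact_mod_cast hy0)
  rw [Finset.mem_filter] at hG₀
  refine ⟨G₀, hG₀.1, blockAverage (P G₀) (adjKernel G₀), blockAverage_mem _ (adjKernel_mem G₀),
    blockAverage_swap _ (adjKernel_swap G₀), hP G₀, ?_⟩
  have h1 := card_mul_exp_sum_I0_le (P G₀) G₀ (C.filter fun G => code G = y) (by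
    intro G hG
    rw [Finset.mem_filter] at hG
    have hcode := hG.2.trans hG₀.2.symm
    have hPG : P G = P G₀ := congrArg Prod.fst hcode
    have hN : ∀ k l, blockCount (P G) G k l = blockCount (P G₀) G₀ k l := fun k l =>
      congrArg Fin.val (congrFun (congrFun (congrArg Prod.snd hcode) k) l)
    funext p
    rw [blockAverage_adjKernel, blockAverage_adjKernel, ← hN, hPG])
  set S := ∑ i, ∑ j, I0 (blockAverage (P G₀) (adjKernel G₀) (i, j))
  have h2 : (C.card : ℝ) / T * exp S ≤ 1 :=
    (mul_le_mul_of_nonneg_right hy (exp_pos _).le).trans h1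
  have h3 := log_le_log (by positivity) h2
  rw [log_mul (by positivity) (exp_pos _).ne', log_exp, log_one, log_div hc.ne' hT.ne'] at h3
  have h4 : log (T : ℝ) = n * log (Fintype.card K) +
      (Fintype.card K : ℝ) ^ 2 * log ((n : ℝ) ^ 2 + 1) := by
    have hK : (0 : ℝ) < Fintype.card K := by
      have : Nonempty K := ⟨P G₀ 0⟩
      exact_mod_cast Fintype.card_pos
    have : (T : ℝ) = (Fintype.card K : ℝ) ^ n *
        (((n : ℝ) ^ 2 + 1) ^ Fintype.card K) ^ Fintype.card K := by
      simp [T, Fintype.card_prod]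
    rw [this, log_mul (by positivity) (by positivity), log_pow, log_pow, log_pow]
    ring
  linarith

end Counting

section Variational

theorem CutLE.abs_homDensity_edgePattern_sub_le {n : ℕ} [NeZero n] {A E : Fin n × Fin n → ℝ}
    {ε : ℝ} (h : CutLE (finMeasure n) (fun p => A p - E p) ε) :
    |homDensity edgePattern A - homDensity edgePattern E| ≤ ε := by
  have h1 := h (fun _ => 1) (fun _ => 1) ⟨measurable_const, by simp⟩ ⟨measurable_const, by simp⟩
  rw [homDensity_edgePattern_eq_integral, homDensity_edgePattern_eq_integral,
    ← integral_sub Integrable.of_finite Integrable.of_finite]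
  simpa using h1

theorem CutLE.abs_homDensity_trianglePattern_sub_le {n : ℕ} [NeZero n]
    {A E : Fin n × Fin n → ℝ} {ε : ℝ} (hA : ∀ p, A p ∈ Icc (0 : ℝ) 1)
    (hE : ∀ p, E p ∈ Icc (0 : ℝ) 1) (h : CutLE (finMeasure n) (fun p => A p - E p) ε) :
    |homDensity trianglePattern A - homDensity trianglePattern E| ≤ 3 * ε := by
  rw [homDensity_trianglePattern_eq_trip, homDensity_trianglePattern_eq_trip]
  exact abs_trip_diag_sub_le Measurable.of_discrete Measurable.of_discrete
    (fun p => abs_le_one_of_mem_Icc (hA p)) (fun p => abs_le_one_of_mem_Icc (hE p)) h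

theorem tendsto_entropy_error (a b : ℝ) :
    Tendsto (fun n : ℕ => (n * a + b * log ((n : ℝ) ^ 2 + 1)) / (n : ℝ) ^ 2) atTop (nhds 0) := by
  have h0 : Tendsto (fun n : ℕ => (n : ℝ)⁻¹) atTop (nhds 0) := tendsto_inv_atTop_nhds_zero_nat
  have h1 : Tendsto (fun n : ℕ => (n : ℝ) ^ 2 + 1) atTop atTop :=
    tendsto_atTop_add_const_right _ _
      ((tendsto_pow_atTop two_ne_zero).comp tendsto_natCast_atTop_atTop)
  have h2 : Tendsto (fun x : ℝ => log x / x) atTop (nhds 0) :=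
    isLittleO_log_id_atTop.tendsto_div_nhds_zero
  have h3 := (h0.const_mul a).add
    (((h2.comp h1).mul ((h0.mul h0).const_add 1)).const_mul b)
  have e : a * 0 + b * (0 * (1 + 0 * 0)) = (0 : ℝ) := by ring
  rw [e] at h3
  refine h3.congr' ?_
  filter_upwards [eventually_gt_atTop 0] with n hn
  have hn' : (0 : ℝ) < n := by exact_mod_cast hn
  simp only [Function.comp]
  field_simp

theorem eventually_exists_kernel {ε : ℝ} (hε : 0 < ε) : ∀ᶠ n : ℕ in atTop, 0 < n ∧
    ∀ δ e t : ℝ, 0 < Z n δ e t → ∃ E : Fin n × Fin n → ℝ,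
      (∀ p, E p ∈ Icc (0 : ℝ) 1) ∧ (∀ p, E p.swap = E p) ∧
      |∫ p, E p ∂((finMeasure n).prod (finMeasure n)) - e| ≤ δ + 4 * ε ∧
      |trip (finMeasure n) E E E - t| ≤ δ + 4 * ε ∧
      ∫ p, I0 (E p) ∂((finMeasure n).prod (finMeasure n)) ≤
        - (log (Z n δ e t) / (n : ℝ) ^ 2) + ε := by
  obtain ⟨N, hN⟩ := exists_nat_gt (1 / (ε / 2) ^ 2)
  have hN' : 1 < N * (ε / 2) ^ 2 := by rwa [div_lt_iff₀ (by positivity)] at hN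
  have h9 : Tendsto (fun n : ℕ => 9 / (n : ℝ)) atTop (nhds 0) :=
    tendsto_const_div_atTop_nhds_zero_nat 9
  filter_upwards [eventually_gt_atTop 0, h9.eventually_lt_const hε,
    (tendsto_entropy_error (log (Fintype.card (Fin N → SignType × SignType)))
      ((Fintype.card (Fin N → SignType × SignType) : ℝ) ^ 2)).eventually_lt_const hε]
    with n hn hn9 hent
  classical
  refine ⟨hn, fun δ e t hZ => ?_⟩
  have hn' : (0 : ℝ) < n := by exact_mod_cast hn
  have : NeZero n := ⟨hn.ne'⟩
  let C : Finset (SimpleGraph (Fin n)) := Finset.univ.filter fun G =>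
    graphEdgeDensity G ∈ Ioo (e - δ) (e + δ) ∧ graphTriangleDensity G ∈ Ioo (t - δ) (t + δ)
  have hCZ : C.card = Z n δ e t := by
    rw [Z, Nat.card_eq_fintype_card, Fintype.card_subtype]
  have hC : C.Nonempty := Finset.card_pos.1 (hCZ ▸ hZ)
  obtain ⟨G, hG, E, hE, hEs, hcut, hlog⟩ := log_card_le (ε := 2 * (ε / 2)) C hC
    fun G => exists_partition (half_pos hε) hN' G
  rw [mul_div_cancel₀ _ two_ne_zero] at hcut
  have hA := adjKernel_mem G
  have a1 := abs_le.1 hcut.abs_homDensity_edgePattern_sub_le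
  have a2 := abs_le.1 (hcut.abs_homDensity_trianglePattern_sub_le hA hE)
  have a3 := abs_le.1 (abs_graphEdgeDensity_sub_le hn G)
  have a4 := abs_le.1 (abs_graphTriangleDensity_sub_le hn G)
  obtain ⟨-, ⟨b1, b2⟩, b3, b4⟩ := Finset.mem_filter.1 hG
  have h49 : 4 / (n : ℝ) ≤ 9 / n := by gcongr; norm_num
  refine ⟨E, hE, hEs, ?_, ?_, ?_⟩
  · rw [← homDensity_edgePattern_eq_integral, abs_le]
    constructor <;> linarith
  · rw [← homDensity_trianglePattern_eq_trip, abs_le]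
    constructor <;> linarith
  · rw [integral_prod_finMeasure, ← hCZ]
    rw [div_lt_iff₀ (by positivity)] at hent
    rw [div_le_iff₀ (by positivity), add_mul, neg_mul, div_mul_cancel₀ _ (by positivity)]
    linarith

theorem rate_mem {g : ℝ → ℝ → ℝ} (hg : IsGraphon g) : rate g ∈ Icc (-1 : ℝ) 0 := by
  rw [rate_eq_integral_prod hg]
  exact ⟨(abs_le.1 (abs_integral_le_of_abs_le fun p => abs_I0_le (hg.2.2 _ _))).1,
    integral_nonpos fun p => I0_nonpos (hg.2.2 _ _)⟩

theorem exists_rate_minimizer {e t : ℝ}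
    (hex : ∃ g, IsGraphon g ∧ edgeDensity g = e ∧ triangleDensity g = t) :
    ∃ g₀, IsGraphon g₀ ∧ edgeDensity g₀ = e ∧ triangleDensity g₀ = t ∧
      ∀ g, IsGraphon g → edgeDensity g = e → triangleDensity g = t → rate g₀ ≤ rate g := by
  let S : Set ℝ := rate '' {g | IsGraphon g ∧ edgeDensity g = e ∧ triangleDensity g = t}
  have hS : S.Nonempty := by
    obtain ⟨g, hg⟩ := hex
    exact ⟨rate g, g, hg, rfl⟩
  have hb : BddBelow S := ⟨-1, by
    rintro _ ⟨g, hg, rfl⟩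
    exact (rate_mem hg.1).1⟩
  obtain ⟨r, -, hr, hrS⟩ := exists_seq_tendsto_sInf hS hb
  choose g hg hgr using hrS
  obtain ⟨g₀, h₀, he, ht, hrate⟩ := exists_graphon_limit (fun _ : ℕ => unitMeasure)
    (fun k => Function.uncurry (g k)) (fun k => (hg k).1.1) (fun k p => (hg k).1.2.2 _ _)
    (fun k p => (hg k).1.2.1 _ _) r (e := e) (t := t) (c := sInf S)
    (tendsto_const_nhds.congr fun k => by
      rw [← (hg k).2.1, edgeDensity_eq_integral_prod (hg k).1]; rfl)
    (tendsto_const_nhds.congr fun k => by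
      rw [← (hg k).2.2, triangleDensity_eq_trip (hg k).1])
    hr (fun k => by
      rw [← hgr k, rate_eq_integral_prod (hg k).1]; rfl)
  exact ⟨g₀, h₀, he, ht, fun g h1 h2 h3 => hrate.trans (csInf_le hb ⟨g, ⟨h1, h2, h3⟩, rfl⟩)⟩

theorem eventually_log_Z_le {e t c : ℝ} (hc : 0 ≤ -c)
    (hmin : ∀ g, IsGraphon g → edgeDensity g = e → triangleDensity g = t → c < rate g) :
    ∀ᶠ δ in nhdsWithin (0 : ℝ) (Ioi 0), ∀ᶠ n : ℕ in atTop,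
      log (Z n δ e t) / (n : ℝ) ^ 2 ≤ -c := by
  by_contra hcon
  rw [not_eventually] at hcon
  have key : ∀ k : ℕ, ∃ n : ℕ, 0 < n ∧ ∃ E : Fin n × Fin n → ℝ,
      (∀ p, E p ∈ Icc (0 : ℝ) 1) ∧ (∀ p, E p.swap = E p) ∧
      |∫ p, E p ∂((finMeasure n).prod (finMeasure n)) - e| ≤ 5 * (1 / ((k : ℝ) + 1)) ∧
      |trip (finMeasure n) E E E - t| ≤ 5 * (1 / ((k : ℝ) + 1)) ∧
      ∫ p, I0 (E p) ∂((finMeasure n).prod (finMeasure n)) ≤ c + 1 / ((k : ℝ) + 1) := by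
    intro k
    have hk : (0 : ℝ) < 1 / ((k : ℝ) + 1) := by positivity
    obtain ⟨δ, hδ, hδk⟩ := (hcon.and_eventually (Ioo_mem_nhdsGT hk)).exists
    rw [not_eventually] at hδ
    obtain ⟨n, hn, hn0, hE⟩ := (hδ.and_eventually (eventually_exists_kernel hk)).exists
    rw [not_le] at hn
    have hZ : 0 < Z n δ e t := by
      rw [Nat.pos_iff_ne_zero]
      intro h0
      rw [h0] at hn
      simp only [Nat.cast_zero, log_zero, zero_div] at hn
      linarith
    obtain ⟨E, h1, h2, h3, h4, h5⟩ := hE δ e t hZ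
    refine ⟨n, hn0, E, h1, h2, ?_, ?_, ?_⟩ <;> linarith [hδk.2]
  choose n hn E hE hEs hEe hEt hEr using key
  have : ∀ k, NeZero (n k) := fun k => ⟨(hn k).ne'⟩
  have h0 : Tendsto (fun k : ℕ => 1 / ((k : ℝ) + 1)) atTop (nhds 0) :=
    tendsto_one_div_add_atTop_nhds_zero_nat
  have h5 : Tendsto (fun k : ℕ => 5 * (1 / ((k : ℝ) + 1))) atTop (nhds 0) := by
    simpa using h0.const_mul 5
  obtain ⟨g, hg, hge, hgt, hgr⟩ := exists_graphon_limit (fun k => finMeasure (n k)) E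
    (fun k => Measurable.of_discrete) hE hEs (fun k => c + 1 / ((k : ℝ) + 1))
    (tendsto_iff_norm_sub_tendsto_zero.2 (squeeze_zero (fun _ => norm_nonneg _) hEe h5))
    (tendsto_iff_norm_sub_tendsto_zero.2 (squeeze_zero (fun _ => norm_nonneg _) hEt h5))
    (by simpa using h0.const_add c) hEr
  exact (hmin g hg hge hgt).not_ge hgr

theorem log_Z_div_mem (n : ℕ) (δ e t : ℝ) :
    log (Z n δ e t) / (n : ℝ) ^ 2 ∈ Icc (0 : ℝ) (log 2) := by
  classical
  refine ⟨div_nonneg (log_natCast_nonneg _) (by positivity), ?_⟩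
  have hlog := log_pos one_lt_two
  refine div_le_of_le_mul₀ (by positivity) hlog.le ?_
  rcases Nat.eq_zero_or_pos (Z n δ e t) with h | h
  · rw [h]
    simp only [Nat.cast_zero, log_zero]
    positivity
  have h1 : Z n δ e t ≤ 2 ^ Fintype.card (EdgeSlot n) := by
    rw [← card_simpleGraph, Z, Nat.card_eq_fintype_card]
    exact Fintype.card_subtype_le _
  have h2 : log (Z n δ e t : ℝ) ≤ Fintype.card (EdgeSlot n) * log 2 := by
    rw [← log_pow]
    exact log_le_log (by exact_mod_cast h) (by exact_mod_cast h1)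
  have h3 : (Fintype.card (EdgeSlot n) : ℝ) ≤ (n : ℝ) ^ 2 := by
    have := two_mul_card_edgeSlot n
    have : (0 : ℝ) ≤ n := Nat.cast_nonneg n
    nlinarith [sq_nonneg (n : ℝ)]
  rw [mul_comm (log 2)]
  exact h2.trans (mul_le_mul_of_nonneg_right h3 hlog.le)

end Variational
/-- for any achievable pair `(e,t)` the double limit
    `s_{e,t} = lim_{δ→0⁺} lim_{n→∞} ln(Z^{n,δ}_{e,t})/n²` exists and equals
    `−min I(g)` over graphons with `e(g)=e`, `t(g)=t`, the min being attained. -/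
theorem entropy_density_variational (e t : ℝ) (he : e ∈ Icc (0 : ℝ) 1) (ht : t ∈ Icc (0 : ℝ) 1)
    (hex : ∃ g, IsGraphon g ∧ edgeDensity g = e ∧ triangleDensity g = t) :
    ∃ g₀, IsGraphon g₀ ∧ edgeDensity g₀ = e ∧ triangleDensity g₀ = t ∧
      (∀ g, IsGraphon g → edgeDensity g = e → triangleDensity g = t → rate g₀ ≤ rate g) ∧
      Tendsto (fun δ : ℝ => liminf (fun n : ℕ => Real.log (Z n δ e t) / (n : ℝ) ^ 2) atTop)
        (nhdsWithin 0 (Ioi 0)) (nhds (-(rate g₀))) ∧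
      Tendsto (fun δ : ℝ => limsup (fun n : ℕ => Real.log (Z n δ e t) / (n : ℝ) ^ 2) atTop)
        (nhdsWithin 0 (Ioi 0)) (nhds (-(rate g₀))) := by
  obtain ⟨g₀, hg₀, hge, hgt, hmin⟩ := exists_rate_minimizer hex
  refine ⟨g₀, hg₀, hge, hgt, hmin, ?_⟩
  have hb1 : ∀ δ, IsBoundedUnder (· ≤ ·) atTop
      fun n : ℕ => Real.log (Z n δ e t) / (n : ℝ) ^ 2 := fun δ =>
    isBoundedUnder_of ⟨log 2, fun n => (log_Z_div_mem n δ e t).2⟩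
  have hb2 : ∀ δ, IsBoundedUnder (· ≥ ·) atTop
      fun n : ℕ => Real.log (Z n δ e t) / (n : ℝ) ^ 2 := fun δ =>
    isBoundedUnder_of ⟨0, fun n => (log_Z_div_mem n δ e t).1⟩
  have hlow : ∀ δ > 0, -(rate g₀) ≤
      liminf (fun n : ℕ => Real.log (Z n δ e t) / (n : ℝ) ^ 2) atTop := by
    intro δ hδ
    refine le_of_forall_lt fun c hc => ?_
    obtain ⟨c', hc1, hc2⟩ := exists_between hc
    have h1 := eventually_le_log_Z hg₀ hδ hc2
    rw [hge, hgt] at h1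
    exact hc1.trans_le (le_liminf_of_le (hb1 δ).isCoboundedUnder_ge h1)
  have hle : ∀ δ, liminf (fun n : ℕ => Real.log (Z n δ e t) / (n : ℝ) ^ 2) atTop ≤
      limsup (fun n : ℕ => Real.log (Z n δ e t) / (n : ℝ) ^ 2) atTop := fun δ =>
    liminf_le_limsup (hb1 δ) (hb2 δ)
  have hup : ∀ a > -(rate g₀), ∀ᶠ δ in nhdsWithin (0 : ℝ) (Ioi 0),
      limsup (fun n : ℕ => Real.log (Z n δ e t) / (n : ℝ) ^ 2) atTop < a := by
    intro a ha
    obtain ⟨b, hb, hba⟩ := exists_between ha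
    have h0 := (rate_mem hg₀).2
    filter_upwards [eventually_log_Z_le (e := e) (t := t) (c := -b) (by linarith)
      fun g h1 h2 h3 => by linarith [hmin g h1 h2 h3]] with δ hδ
    rw [neg_neg] at hδ
    exact (limsup_le_of_le (hb2 δ).isCoboundedUnder_le hδ).trans_lt hba
  constructor
  · refine tendsto_order.2 ⟨fun a ha => ?_, fun a ha => ?_⟩
    · filter_upwards [self_mem_nhdsWithin] with δ hδ
      exact ha.trans_le (hlow δ hδ)
    · filter_upwards [hup a ha] with δ hδ
      exact (hle δ).trans_lt hδ
  · refine tendsto_order.2 ⟨fun a ha => ?_, fun a ha => hup a ha⟩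
    filter_upwards [self_mem_nhdsWithin] with δ hδ
    exact ha.trans_le ((hlow δ hδ).trans (hle δ))
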